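/- (Lemma B.2, simultaneous simplification and structure retention for ANY∘{SYM,THR}∘AC^0 circuits.) There exists an absolute constant τ > 0 such that for every depth d ∈ ℕ there exist c_d > 0 and n₀ with the following property: for all n ≥ n₀ of the form n = m(k+1)r with m = r and k = ⌊0.0005·log₂ m⌋, set u = ⌊n^{0.249}⌋ and s = n^{τ·log₂ n}, and let F(x) = h(F_1(x),…,F_u(x)) where h : {0,1}^u → {0,1} is arbitrary and each F_i is computed by a circuit of size at most s whose top gate is SYM or THR fed by depth-d AC^0 circuits. Then there is a fair distribution R over restrictions ρ ∈ {0,1,*}^n such that with probability at least 1 − exp(−c_d·n^{0.49}) over ρ ← R, both of the following hold: (i) F↾ρ(x) = h(F'_1(x),…,F'_u(x)) where each F'_i is computed by a SYM∘AND_k or THR∘AND_k circuit of size at most s²; and (ii) RW_{m,k,r}↾ρ contains a perfect copy of GIP_{m/2,k+1}. -/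

import Mathlib

open Finset

/-! ### AC⁰ circuits: unbounded fan-in AND/OR gates over literals -/

inductive AC0 (ι : Type) : Type
  | lit : ι → Bool → AC0 ι
  | and : (a : ℕ) → (Fin a → AC0 ι) → AC0 ι
  | or  : (a : ℕ) → (Fin a → AC0 ι) → AC0 ι

namespace AC0

variable {ι : Type}

def eval : AC0 ι → (ι → Bool) → Bool
  | .lit i b, x => if b then x i else !(x i)
  | .and _ f, x => decide (∀ j, (f j).eval x = true)
  | .or _ f, x => decide (∃ j, (f j).eval x = true)

/-- Number of gates, literals included in the count. -/
def size : AC0 ι → ℕ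
  | .lit _ _ => 1
  | .and _ f => 1 + ∑ j, (f j).size
  | .or _ f => 1 + ∑ j, (f j).size

def depth : AC0 ι → ℕ
  | .lit _ _ => 0
  | .and _ f => 1 + Finset.univ.sup fun j => (f j).depth
  | .or _ f => 1 + Finset.univ.sup fun j => (f j).depth

end AC0

/-- `g` is an arbitrary symmetric Boolean function: it depends only on the
number of `true`s among its inputs. -/
def IsSymFun {a : ℕ} (g : (Fin a → Bool) → Bool) : Prop :=
  ∃ φ : ℕ → Bool, ∀ y, g y = φ (Finset.univ.filter fun i => y i = true).card

/-- `g` is an arbitrary linear threshold function: `g y = 1` iff `∑ wᵢ yᵢ ≥ θ`. -/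
def IsThrFun {a : ℕ} (g : (Fin a → Bool) → Bool) : Prop :=
  ∃ (w : Fin a → ℝ) (θ : ℝ), ∀ y, g y = decide (θ ≤ ∑ i, if y i = true then w i else 0)

/-- `F` is computed by a SYM∘AC⁰ circuit: a symmetric output gate fed by
AC⁰ circuits of depth at most `d`, with at most `S` gates in total
(the top gate and all gates of the feeding circuits, literals included). -/
def SymOnAC0 {ι : Type} (S : ℝ) (d : ℕ) (F : (ι → Bool) → Bool) : Prop :=
  ∃ (a : ℕ) (g : (Fin a → Bool) → Bool) (C : Fin a → AC0 ι),
    IsSymFun g ∧ (∀ i, (C i).depth ≤ d) ∧ (((1 + ∑ i, (C i).size : ℕ) : ℝ) ≤ S) ∧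
    ∀ x, F x = g fun i => (C i).eval x

/-- `F` is computed by a THR∘AC⁰ circuit, analogously. -/
def ThrOnAC0 {ι : Type} (S : ℝ) (d : ℕ) (F : (ι → Bool) → Bool) : Prop :=
  ∃ (a : ℕ) (g : (Fin a → Bool) → Bool) (C : Fin a → AC0 ι),
    IsThrFun g ∧ (∀ i, (C i).depth ≤ d) ∧ (((1 + ∑ i, (C i).size : ℕ) : ℝ) ≤ S) ∧
    ∀ x, F x = g fun i => (C i).eval x

/-! ### General circuits with AND/OR gates and arbitrary SYM/THR gates -/

inductive GenCircuit (ι : Type) : Type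
  | lit : ι → Bool → GenCircuit ι
  | and : (a : ℕ) → (Fin a → GenCircuit ι) → GenCircuit ι
  | or  : (a : ℕ) → (Fin a → GenCircuit ι) → GenCircuit ι
  | sym : (a : ℕ) → (ℕ → Bool) → (Fin a → GenCircuit ι) → GenCircuit ι
  | thr : (a : ℕ) → (Fin a → ℝ) → ℝ → (Fin a → GenCircuit ι) → GenCircuit ι

namespace GenCircuit

variable {ι : Type}

noncomputable def eval : GenCircuit ι → (ι → Bool) → Bool
  | .lit i b, x => if b then x i else !(x i)
  | .and _ f, x => decide (∀ j, (f j).eval x = true)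
  | .or _ f, x => decide (∃ j, (f j).eval x = true)
  | .sym _ φ f, x => φ (Finset.univ.filter fun j => (f j).eval x = true).card
  | .thr _ w θ f, x => decide (θ ≤ ∑ j, if (f j).eval x = true then w j else 0)

/-- Number of gates, literals included in the count. -/
def size : GenCircuit ι → ℕ
  | .lit _ _ => 1
  | .and _ f => 1 + ∑ j, (f j).size
  | .or _ f => 1 + ∑ j, (f j).size
  | .sym _ _ f => 1 + ∑ j, (f j).size
  | .thr _ _ _ f => 1 + ∑ j, (f j).size

def depth : GenCircuit ι → ℕ
  | .lit _ _ => 0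
  | .and _ f => 1 + Finset.univ.sup fun j => (f j).depth
  | .or _ f => 1 + Finset.univ.sup fun j => (f j).depth
  | .sym _ _ f => 1 + Finset.univ.sup fun j => (f j).depth
  | .thr _ _ _ f => 1 + Finset.univ.sup fun j => (f j).depth

/-- The number of SYM and THR gates in the circuit. -/
def symThrCount : GenCircuit ι → ℕ
  | .lit _ _ => 0
  | .and _ f => ∑ j, (f j).symThrCount
  | .or _ f => ∑ j, (f j).symThrCount
  | .sym _ _ f => 1 + ∑ j, (f j).symThrCount
  | .thr _ _ _ f => 1 + ∑ j, (f j).symThrCount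

end GenCircuit

/-! ### Restrictions and distributions -/

/-- Apply a restriction (`none` = `*` = free) to an input. -/
def applyR {ι : Type} (ρ : ι → Option Bool) (x : ι → Bool) : ι → Bool :=
  fun i => (ρ i).getD (x i)

/-- The restricted function `f↾ρ`. -/
def restrictF {ι : Type} (f : (ι → Bool) → Bool) (ρ : ι → Option Bool) :
    (ι → Bool) → Bool :=
  fun x => f (applyR ρ x)

def freeCount {ι : Type} [Fintype ι] (ρ : ι → Option Bool) : ℕ :=
  (Finset.univ.filter fun i => ρ i = none).card

open Classical in
/-- Probability of the event `P` under the (finitely supported) density `R`. -/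
noncomputable def prOf {α : Type} [Fintype α] (R : α → ℝ) (P : α → Prop) : ℝ :=
  ∑ a, if P a then R a else 0

/-- A density `R` on restrictions is a fair distribution: it is a probability
distribution, and drawing `ρ ← R` and filling in all `*`s with independent
uniform bits yields the uniform distribution on `{0,1}^n`. -/
def IsFair {ι : Type} [Fintype ι] [DecidableEq ι] (R : (ι → Option Bool) → ℝ) : Prop :=
  (∀ ρ, 0 ≤ R ρ) ∧ ((∑ ρ : ι → Option Bool, R ρ) = 1) ∧
  ∀ x : ι → Bool,
    (∑ ρ : ι → Option Bool, R ρ * if applyR ρ x = x then ((1 : ℝ) / 2) ^ freeCount ρ else 0)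
      = ((1 : ℝ) / 2) ^ Fintype.card ι

/-- The density of the random restriction `R_p`: each coordinate independently
is `*` with probability `p`, and `0` or `1` each with probability `(1-p)/2`. -/
noncomputable def RpDensity {ι : Type} [Fintype ι] (p : ℝ) (ρ : ι → Option Bool) : ℝ :=
  ∏ i, (ρ i).elim p (fun _ => (1 - p) / 2)

/-- The density of the random subset `L ⊆_q ι` (as an indicator function):
each element is included independently with probability `q`. -/
noncomputable def subsetDensity {ι : Type} [Fintype ι] (q : ℝ) (L : ι → Bool) : ℝ :=
  ∏ i, if L i then q else 1 - q

/-- The fraction of inputs on which `F` and `H` agree. -/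
noncomputable def agreePr {ι : Type} [Fintype ι] [DecidableEq ι]
    (F H : (ι → Bool) → Bool) : ℝ :=
  ((Finset.univ.filter fun x : ι → Bool => F x = H x).card : ℝ) / 2 ^ Fintype.card ι

/-- `G : {0,1}^t → {0,1}^ι` ε-fools the Boolean function `f`. -/
def Fools {ι : Type} [Fintype ι] [DecidableEq ι] {t : ℕ}
    (G : (Fin t → Bool) → (ι → Bool)) (f : (ι → Bool) → Bool) (ε : ℝ) : Prop :=
  |(∑ s : Fin t → Bool, if f (G s) = true then (1 : ℝ) else 0) / 2 ^ t
    - (∑ x : ι → Bool, if f x = true then (1 : ℝ) else 0) / 2 ^ Fintype.card ι| ≤ ε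

/-! ### Decision trees -/

inductive DTree (ι : Type) (α : Type) : Type
  | leaf : α → DTree ι α
  | node : ι → DTree ι α → DTree ι α → DTree ι α

namespace DTree

variable {ι α : Type}

def depth : DTree ι α → ℕ
  | .leaf _ => 0
  | .node _ t0 t1 => 1 + max t0.depth t1.depth

def evalWith (ev : α → (ι → Bool) → Bool) : DTree ι α → (ι → Bool) → Bool
  | .leaf a, x => ev a x
  | .node i t0 t1, x => if x i then t1.evalWith ev x else t0.evalWith ev x

def leaves : DTree ι α → List α
  | .leaf a => [a]
  | .node _ t0 t1 => t0.leaves ++ t1.leaves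

end DTree

/-- Evaluation of an ordinary decision tree with Boolean leaves. -/
def evalDT {ι : Type} (T : DTree ι Bool) (x : ι → Bool) : Bool :=
  T.evalWith (fun b _ => b) x

/-- `F` is computed by a `(t, C)`-decision tree: a depth-`t` decision tree
whose leaves are labeled by functions from the class `C`. -/
def ComputedByClassDT {ι : Type} (t : ℕ) (C : ((ι → Bool) → Bool) → Prop)
    (F : (ι → Bool) → Bool) : Prop :=
  ∃ T : DTree ι ((ι → Bool) → Bool), T.depth ≤ t ∧ (∀ g ∈ T.leaves, C g) ∧
    ∀ x, F x = T.evalWith (fun g => g) x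

/-! ### SYM∘AND and THR∘AND circuits -/

/-- `F` is computed by a SYM∘AND circuit with at most `S` bottom AND gates
(terms), each a conjunction of at most `kb` literals. -/
def IsSymAnd {ι : Type} (S kb : ℝ) (F : (ι → Bool) → Bool) : Prop :=
  ∃ (a : ℕ) (g : (Fin a → Bool) → Bool) (T : Fin a → List (ι × Bool)),
    IsSymFun g ∧ ((a : ℝ) ≤ S) ∧ (∀ i, ((T i).length : ℝ) ≤ kb) ∧
    ∀ x, F x = g fun i => (T i).all fun l => x l.1 == l.2

/-- `F` is computed by a THR∘AND circuit, analogously. -/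
def IsThrAnd {ι : Type} (S kb : ℝ) (F : (ι → Bool) → Bool) : Prop :=
  ∃ (a : ℕ) (g : (Fin a → Bool) → Bool) (T : Fin a → List (ι × Bool)),
    IsThrFun g ∧ ((a : ℝ) ≤ S) ∧ (∀ i, ((T i).length : ℝ) ≤ kb) ∧
    ∀ x, F x = g fun i => (T i).all fun l => x l.1 == l.2

/-! ### The Razborov–Wigderson and generalized inner product functions -/

/-- Parity (XOR) of a finite family of bits. -/
def bparity {α : Type} [Fintype α] (f : α → Bool) : Bool :=
  decide ((Finset.univ.filter fun a => f a = true).card % 2 = 1)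

/-- `RW_{m,k,r}(x) = ⊕_{i∈[m]} ⋀_{j∈[k+1]} ⊕_{ℓ∈[r]} x_{i,j,ℓ}`. -/
def RW (m k r : ℕ) (x : Fin m × Fin (k + 1) × Fin r → Bool) : Bool :=
  bparity fun i : Fin m =>
    decide (∀ j : Fin (k + 1), bparity (fun ℓ : Fin r => x (i, j, ℓ)) = true)

/-- `GIP_{m',k'}(x) = ⊕_{i∈[m']} ⋀_{j∈[k']} x_{i,j}`. -/
def GIP (m' k' : ℕ) (x : Fin m' × Fin k' → Bool) : Bool :=
  bparity fun i : Fin m' => decide (∀ j : Fin k', x (i, j) = true)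

/-- `g` contains a perfect copy of `GIP_{m',k'}`: there is a restriction `κ`
whose free variables are exactly the range of an injection `e` from the GIP
index set, and bits `b`, `bb i j`, such that `g↾κ` is the corresponding
shifted/negated copy of GIP. -/
def ContainsGIP {ι : Type} (m' k' : ℕ) (g : (ι → Bool) → Bool) : Prop :=
  ∃ (κ : ι → Option Bool) (e : Fin m' × Fin k' → ι) (b : Bool)
    (bb : Fin m' × Fin k' → Bool),
    Function.Injective e ∧ (∀ v, κ v = none ↔ v ∈ Set.range e) ∧
    ∀ x : ι → Bool,
      g (applyR κ x) =
        xor b (bparity fun i : Fin m' =>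
          decide (∀ j : Fin k', xor (bb (i, j)) (x (e (i, j))) = true))

/-- `g` contains a perfect copy of `RW_{m',k',r'}`, analogously. -/
def ContainsRW {ι : Type} (m' k' r' : ℕ) (g : (ι → Bool) → Bool) : Prop :=
  ∃ (κ : ι → Option Bool) (e : Fin m' × Fin (k' + 1) × Fin r' → ι) (b : Bool)
    (bb : Fin m' × Fin (k' + 1) → Bool),
    Function.Injective e ∧ (∀ v, κ v = none ↔ v ∈ Set.range e) ∧
    ∀ x : ι → Bool,
      g (applyR κ x) =
        xor b (bparity fun i : Fin m' =>
          decide (∀ j : Fin (k' + 1),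
            xor (bb (i, j)) (bparity fun ℓ : Fin r' => x (e (i, j, ℓ))) = true))

namespace SwL

variable {ι : Type}

/-- `x` and `y` agree off `S`. -/
def AgOff (S : Finset ι) (x y : ι → Bool) : Prop := ∀ i, i ∉ S → x i = y i

/-- `f` is computed by a depth-`w` decision tree on the cube of all `y` agreeing with `x` off `S`. -/
def Simple (w : ℕ) (f : (ι → Bool) → Bool) (S : Finset ι) (x : ι → Bool) : Prop :=
  ∃ T : DTree ι Bool, T.depth ≤ w ∧ ∀ y, AgOff S x y → f y = evalDT T y

theorem AgOff.symm {S : Finset ι} {x y : ι → Bool} (h : AgOff S x y) : AgOff S y x :=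
  fun i hi => (h i hi).symm

theorem AgOff.trans {S : Finset ι} {x y z : ι → Bool} (h : AgOff S x y) (h' : AgOff S y z) :
    AgOff S x z := fun i hi => (h i hi).trans (h' i hi)

theorem AgOff.mono {S S' : Finset ι} {x y : ι → Bool} (h : AgOff S x y) (hS : S ⊆ S') :
    AgOff S' x y := fun i hi => h i (fun h' => hi (hS h'))

theorem AgOff.rfl' (S : Finset ι) (x : ι → Bool) : AgOff S x x := fun _ _ => rfl

theorem Simple.mono {w w' : ℕ} {f : (ι → Bool) → Bool} {S S' : Finset ι} {x : ι → Bool}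
    (h : Simple w f S x) (hS : S' ⊆ S) (hw : w ≤ w') : Simple w' f S' x := by
  obtain ⟨T, hT, hf⟩ := h
  exact ⟨T, hT.trans hw, fun y hy => hf y (hy.mono hS)⟩

theorem Simple.congr_x {w : ℕ} {f : (ι → Bool) → Bool} {S : Finset ι} {x x' : ι → Bool}
    (h : Simple w f S x) (hx : AgOff S x x') : Simple w f S x' := by
  obtain ⟨T, hT, hf⟩ := h
  exact ⟨T, hT, fun y hy => hf y (hx.trans hy)⟩

theorem Simple.congr_f {w : ℕ} {f g : (ι → Bool) → Bool} {S : Finset ι} {x : ι → Bool}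
    (h : Simple w f S x) (hfg : ∀ y, AgOff S x y → g y = f y) : Simple w g S x := by
  obtain ⟨T, hT, hf⟩ := h
  exact ⟨T, hT, fun y hy => (hfg y hy).trans (hf y hy)⟩

def negT : DTree ι Bool → DTree ι Bool
  | .leaf b => .leaf (!b)
  | .node i a b => .node i (negT a) (negT b)

theorem negT_depth (T : DTree ι Bool) : (negT T).depth = T.depth := by
  induction T with
  | leaf b => rfl
  | node i a b iha ihb => simp [negT, DTree.depth, iha, ihb]

theorem evalDT_leaf (b : Bool) (x : ι → Bool) : evalDT (.leaf b) x = b := rfl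

theorem evalDT_node (i : ι) (a b : DTree ι Bool) (x : ι → Bool) :
    evalDT (.node i a b) x = if x i then evalDT b x else evalDT a x := rfl

theorem negT_eval (T : DTree ι Bool) (x : ι → Bool) : evalDT (negT T) x = !(evalDT T x) := by
  induction T with
  | leaf b => rfl
  | node i a b iha ihb =>
    simp only [negT, evalDT_node, iha, ihb]
    split <;> rfl

theorem Simple.neg {w : ℕ} {f : (ι → Bool) → Bool} {S : Finset ι} {x : ι → Bool}
    (h : Simple w f S x) : Simple w (fun y => !(f y)) S x := by
  obtain ⟨T, hT, hf⟩ := h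
  exact ⟨negT T, by rw [negT_depth]; exact hT, fun y hy => by simp only [negT_eval, hf y hy]⟩

variable [DecidableEq ι]

/-- overwrite `x` on `V` by `a`. -/
def ow (V : Finset ι) (a x : ι → Bool) : ι → Bool := fun i => if i ∈ V then a i else x i

/-- indicator function of a set. -/
def ind (A : Finset ι) : ι → Bool := fun i => decide (i ∈ A)

theorem Simple.query {w : ℕ} {f : (ι → Bool) → Bool} {V : Finset ι} :
    ∀ {S : Finset ι} {x : ι → Bool}, V ⊆ S →
    (∀ A ⊆ V, Simple w f (S \ V) (ow V (ind A) x)) → Simple (V.card + w) f S x := by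
  induction V using Finset.induction_on with
  | empty =>
    intro S x _ h
    have h0 := h ∅ (by simp)
    simp only [sdiff_empty] at h0
    have : ow ∅ (ind ∅) x = x := by funext i; simp [ow]
    rw [this] at h0
    simpa using h0
  | insert v V hv ih =>
    intro S x hVS h
    have key : ∀ b : Bool, Simple (V.card + w) f (S \ {v}) (ow {v} (fun _ => b) x) := by
      intro b
      apply ih
      · intro i hi
        simp only [mem_sdiff, mem_singleton]
        exact ⟨hVS (mem_insert_of_mem hi), fun h => hv (h ▸ hi)⟩
      · intro A hA
        have h1 := h (if b then insert v A else A) (by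
          split
          · exact insert_subset_insert _ hA
          · exact hA.trans (subset_insert _ _))
        have e1 : S \ insert v V = (S \ {v}) \ V := by ext i; simp; tauto
        rw [e1] at h1
        convert h1 using 1
        funext i
        by_cases hi : i = v
        · subst hi
          have : i ∉ A := fun h => hv (hA h)
          cases b <;> simp [ow, ind, hv, this]
        · cases b <;> simp [ow, ind, hi]
    obtain ⟨T0, hT0, h0⟩ := key false
    obtain ⟨T1, hT1, h1⟩ := key true
    refine ⟨.node v T0 T1, ?_, ?_⟩
    · rw [card_insert_of_notMem hv]
      simp only [DTree.depth]
      omega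
    · intro y hy
      rw [evalDT_node]
      have hag : AgOff (S \ {v}) (ow {v} (fun _ => y v) x) y := by
        intro i hi
        by_cases hiv : i = v
        · subst hiv; simp [ow]
        · simp only [ow, mem_singleton, hiv, if_false]
          apply hy
          intro hS
          exact hi (by simp [hS, hiv])
      cases hb : y v
      · rw [hb] at hag
        simpa using h0 y hag
      · rw [hb] at hag
        simpa using h1 y hag

/-! ### terms and rounds -/

abbrev Term (ι : Type) := Finset ι × (ι → Bool)

def sat (y : ι → Bool) (T : Term ι) : Bool := decide (∀ i ∈ T.1, y i = T.2 i)

def alive (S : Finset ι) (x : ι → Bool) (T : Term ι) : Bool :=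
  decide (∀ i ∈ T.1, i ∉ S → x i = T.2 i)

def dnf (τ : List (Term ι)) (y : ι → Bool) : Bool := τ.any (sat y)

/-- possible outcomes of one round of decoding. -/
def RO (τ : List (Term ι)) : ℕ → (ι → Bool) → Finset (Finset ι)
  | 0, _ => ∅
  | n + 1, y =>
    match τ.find? (sat y) with
    | none => ∅
    | some T => (T.1.powerset.erase ∅).biUnion fun V => V.powerset.biUnion fun A =>
        {V} ∪ (((RO τ n (ow V (ind A) y)).filter (fun Q => Disjoint V Q)).image (fun Q => V ∪ Q))

theorem find_transfer {α : Type} {P Q : α → Bool} {l : List α} {T : α}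
    (h : l.find? P = some T) (h1 : ∀ a, Q a = true → P a = true) (h2 : Q T = true) :
    l.find? Q = some T := by
  induction l with
  | nil => simp at h
  | cons a l ih =>
    rw [List.find?_cons] at h ⊢
    cases hP : P a with
    | true =>
      rw [hP] at h
      simp only [Option.some.injEq] at h
      subst h
      rw [h2]
    | false =>
      rw [hP] at h
      have : Q a = false := by
        cases hQ : Q a
        · rfl
        · rw [h1 a hQ] at hP; exact absurd hP (by simp)
      rw [this]
      exact ih h

theorem round_exists (τ : List (Term ι)) (w : ℕ) (hw : ∀ T ∈ τ, T.1.card ≤ w) (n : ℕ) :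
    ∀ (w' : ℕ) (S : Finset ι) (x : ι → Bool), w' < n → ¬ Simple w' (dnf τ) S x →
    ∃ (Q : Finset ι) (σ : ι → Bool), Q ⊆ S ∧ w' < Q.card ∧ Q.card ≤ w' + w ∧
      ∀ y, AgOff S x y → (∀ i ∈ Q, y i = σ i) → Q ∈ RO τ n y := by
  induction n with
  | zero => intro w' S x h; omega
  | succ n ih =>
    intro w' S x hn hns
    cases hf : τ.find? (alive S x) with
    | none =>
      exfalso
      apply hns
      refine ⟨.leaf false, by simp [DTree.depth], fun y hy => ?_⟩
      rw [evalDT_leaf]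
      rw [List.find?_eq_none] at hf
      simp only [dnf, List.any_eq_false]
      intro T hT hs
      apply hf T hT
      simp only [sat, decide_eq_true_eq] at hs
      simp only [alive, decide_eq_true_eq]
      intro i hi hiS
      rw [hy i hiS, hs i hi]
    | some T =>
      obtain ⟨V0, a⟩ := T
      have hTmem := List.mem_of_find?_eq_some hf
      have hTal := List.find?_some hf
      simp only [alive, decide_eq_true_eq] at hTal
      set V := V0 ∩ S with hV
      have hVS : V ⊆ S := inter_subset_right
      have hVV0 : V ⊆ V0 := inter_subset_left
      have hVw : V.card ≤ w := (card_le_card hVV0).trans (hw _ hTmem)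
      -- first satisfied term
      have hfind : ∀ y, AgOff S x y → (∀ i ∈ V, y i = a i) → τ.find? (sat y) = some (V0, a) := by
        intro y hy hya
        refine find_transfer hf ?_ ?_
        · intro T hT
          simp only [sat, decide_eq_true_eq] at hT
          simp only [alive, decide_eq_true_eq]
          intro i hi hiS
          rw [hy i hiS, hT i hi]
        · simp only [sat, decide_eq_true_eq]
          intro i hi
          by_cases hiS : i ∈ S
          · exact hya i (by simp [hV, hi, hiS])
          · rw [← hy i hiS]; exact hTal i hi hiS
      have hVne : V ≠ ∅ := by
        intro hV0
        apply hns
        refine ⟨.leaf true, by simp [DTree.depth], fun y hy => ?_⟩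
        rw [evalDT_leaf]
        simp only [dnf, List.any_eq_true]
        refine ⟨_, hTmem, ?_⟩
        exact List.find?_some (hfind y hy (by simp [hV0]))
      have hVpos : 0 < V.card := card_pos.mpr (nonempty_iff_ne_empty.mpr hVne)
      by_cases hbig : w' < V.card
      · refine ⟨V, a, hVS, hbig, by omega, fun y hy hya => ?_⟩
        simp only [RO, hfind y hy hya]
        simp only [mem_biUnion, mem_erase, mem_powerset, mem_union, mem_singleton]
        exact ⟨V, ⟨hVne, hVV0⟩, ∅, by simp, Or.inl rfl⟩
      · push Not at hbig
        have : ∃ A ⊆ V, ¬ Simple (w' - V.card) (dnf τ) (S \ V) (ow V (ind A) x) := by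
          by_contra hcon
          push Not at hcon
          apply hns
          have := Simple.query hVS hcon
          rwa [Nat.add_sub_cancel' hbig] at this
        obtain ⟨A, hA, hAns⟩ := this
        obtain ⟨Q', σ', hQS, hQ1, hQ2, hQ3⟩ := ih (w' - V.card) _ _ (by omega) hAns
        have hdisj : Disjoint V Q' := by
          rw [disjoint_left]
          intro i hi hi'
          exact (mem_sdiff.mp (hQS hi')).2 hi
        refine ⟨V ∪ Q', ow V a σ', ?_, ?_, ?_, ?_⟩
        · exact union_subset hVS (hQS.trans sdiff_subset)
        · rw [card_union_of_disjoint hdisj]; omega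
        · rw [card_union_of_disjoint hdisj]; omega
        · intro y hy hyσ
          have hyV : ∀ i ∈ V, y i = a i := by
            intro i hi
            have := hyσ i (mem_union_left _ hi)
            simpa [ow, hi] using this
          simp only [RO, hfind y hy hyV]
          simp only [mem_biUnion, mem_erase, mem_powerset, mem_union, mem_singleton, mem_image,
            mem_filter]
          refine ⟨V, ⟨hVne, hVV0⟩, A, hA, Or.inr ⟨Q', ⟨?_, hdisj⟩, rfl⟩⟩
          apply hQ3
          · intro i hi
            by_cases hiV : i ∈ V
            · simp [ow, hiV]
            · simp only [ow, hiV, if_false]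
              exact hy i (fun h => hi (mem_sdiff.mpr ⟨h, hiV⟩))
          · intro i hi
            have hiV : i ∉ V := disjoint_right.mp hdisj hi
            have := hyσ i (mem_union_right _ hi)
            simpa [ow, hiV] using this

theorem sum_biUnion_le' {α β : Type} [DecidableEq β] (s : Finset α) (t : α → Finset β) (g : β → ℝ)
    (hg : ∀ b, 0 ≤ g b) : ∑ b ∈ s.biUnion t, g b ≤ ∑ a ∈ s, ∑ b ∈ t a, g b := by
  classical
  induction s using Finset.induction_on with
  | empty => simp
  | insert a s ha ih =>
    rw [biUnion_insert, sum_insert ha]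
    have := sum_union_inter (s₁ := t a) (s₂ := s.biUnion t) (f := g)
    have h2 : 0 ≤ ∑ b ∈ t a ∩ s.biUnion t, g b := sum_nonneg fun b _ => hg b
    linarith

theorem sum_image_le' {α β : Type} [DecidableEq β] (s : Finset α) (t : α → β) (g : β → ℝ)
    (hg : ∀ b, 0 ≤ g b) : ∑ b ∈ s.image t, g b ≤ ∑ a ∈ s, g (t a) := by
  classical
  induction s using Finset.induction_on with
  | empty => simp
  | insert a s ha ih =>
    rw [image_insert, sum_insert ha]
    by_cases h : t a ∈ s.image t
    · rw [insert_eq_of_mem h]; linarith [hg (t a)]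
    · rw [sum_insert h]; linarith

theorem RO_weight (τ : List (Term ι)) (w : ℕ) (hw : ∀ T ∈ τ, T.1.card ≤ w) (ζ : ℝ) (hζ : 0 ≤ ζ)
    (h1 : (1 + 2 * ζ) ^ w ≤ 3 / 2) (n : ℕ) :
    ∀ y, ∑ Q ∈ RO τ n y, ζ ^ Q.card ≤ 1 := by
  induction n with
  | zero => intro y; simp [RO]
  | succ n ih =>
    intro y
    simp only [RO]
    cases hf : τ.find? (sat y) with
    | none => simp
    | some T =>
      have hTmem := List.mem_of_find?_eq_some hf
      simp only
      have hnn : ∀ Q : Finset ι, 0 ≤ ζ ^ Q.card := fun Q => pow_nonneg hζ _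
      refine (sum_biUnion_le' _ _ _ hnn).trans ?_
      have step : ∀ V ∈ T.1.powerset.erase ∅, ∑ Q ∈ (V.powerset.biUnion fun A =>
        {V} ∪ (((RO τ n (ow V (ind A) y)).filter (fun Q => Disjoint V Q)).image (fun Q => V ∪ Q))),
          ζ ^ Q.card ≤ 2 * (2 * ζ) ^ V.card := by
        intro V _
        refine (sum_biUnion_le' _ _ _ hnn).trans ?_
        have : ∀ A ∈ V.powerset, ∑ Q ∈ {V} ∪ (((RO τ n (ow V (ind A) y)).filter
            (fun Q => Disjoint V Q)).image (fun Q => V ∪ Q)), ζ ^ Q.card ≤ 2 * ζ ^ V.card := by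
          intro A _
          have hu := sum_union_inter (s₁ := {V}) (s₂ := (((RO τ n (ow V (ind A) y)).filter
            (fun Q => Disjoint V Q)).image (fun Q => V ∪ Q))) (f := fun Q => ζ ^ Q.card)
          have h2 : 0 ≤ ∑ Q ∈ {V} ∩ (((RO τ n (ow V (ind A) y)).filter
            (fun Q => Disjoint V Q)).image (fun Q => V ∪ Q)), ζ ^ Q.card :=
              sum_nonneg fun b _ => hnn b
          rw [sum_singleton] at hu
          have h3 : ∑ Q ∈ (((RO τ n (ow V (ind A) y)).filter
            (fun Q => Disjoint V Q)).image (fun Q => V ∪ Q)), ζ ^ Q.card ≤ ζ ^ V.card := by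
            refine (sum_image_le' _ _ _ hnn).trans ?_
            calc ∑ Q ∈ (RO τ n (ow V (ind A) y)).filter (fun Q => Disjoint V Q), ζ ^ (V ∪ Q).card
                = ∑ Q ∈ (RO τ n (ow V (ind A) y)).filter (fun Q => Disjoint V Q),
                    ζ ^ V.card * ζ ^ Q.card := by
                  apply sum_congr rfl
                  intro Q hQ
                  rw [card_union_of_disjoint (mem_filter.mp hQ).2, pow_add]
              _ = ζ ^ V.card * ∑ Q ∈ (RO τ n (ow V (ind A) y)).filter (fun Q => Disjoint V Q),
                    ζ ^ Q.card := by rw [mul_sum]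
              _ ≤ ζ ^ V.card * 1 := by
                  apply mul_le_mul_of_nonneg_left _ (hnn V)
                  refine le_trans ?_ (ih (ow V (ind A) y))
                  exact sum_le_sum_of_subset_of_nonneg (filter_subset _ _) fun b _ _ => hnn b
              _ = ζ ^ V.card := mul_one _
          linarith
        refine (sum_le_sum this).trans ?_
        rw [sum_const, card_powerset, nsmul_eq_mul, mul_pow]
        push_cast
        apply le_of_eq; ring
      refine (sum_le_sum step).trans ?_
      rw [← mul_sum]
      have hs : ∑ V ∈ T.1.powerset, (2 * ζ) ^ V.card = (1 + 2 * ζ) ^ T.1.card := by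
        have := Finset.sum_pow_mul_eq_add_pow (2 * ζ) 1 T.1
        simp only [one_pow, mul_one] at this
        rw [this, add_comm]
      have he := Finset.add_sum_erase T.1.powerset (fun V => (2 * ζ) ^ V.card)
        (empty_mem_powerset T.1)
      simp only [card_empty, pow_zero] at he
      have hle : (1 + 2 * ζ) ^ T.1.card ≤ (1 + 2 * ζ) ^ w :=
        pow_le_pow_right₀ (by linarith) (hw _ hTmem)
      linarith

end SwL

namespace SwL

set_option linter.unusedSectionVars false

variable {ι : Type} [Fintype ι] [DecidableEq ι] {κ : Type} [Fintype κ]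

/-- possible outcomes of `t` rounds of decoding. -/
def Out (τ : κ → List (Term ι)) (w' : ℕ) : ℕ → (ι → Bool) → Finset (Finset ι × (ι → Bool))
  | 0, y => {(∅, y)}
  | t + 1, y => (univ : Finset κ).biUnion fun i =>
      ((RO (τ i) (w' + 1) y).filter (fun Q => w' < Q.card)).biUnion fun Q =>
        Q.powerset.biUnion fun A =>
          ((Out τ w' t (ow Q (ind A) y)).filter (fun z => Disjoint Q z.1)).image
            (fun z => (Q ∪ z.1, z.2))

theorem Out_weight (τ : κ → List (Term ι)) (w w' : ℕ) (hw : ∀ i, ∀ T ∈ τ i, T.1.card ≤ w)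
    (ζ θ p : ℝ) (hζ : 0 ≤ ζ) (hθ : 0 ≤ θ) (hθ1 : θ ≤ 1) (hp : 2 * p = ζ * θ)
    (h1 : (1 + 2 * ζ) ^ w ≤ 3 / 2) (t : ℕ) :
    ∀ y, ∑ z ∈ Out τ w' t y, p ^ z.1.card ≤ ((Fintype.card κ : ℝ) * θ ^ (w' + 1)) ^ t := by
  have hp0 : 0 ≤ p := by nlinarith [mul_nonneg hζ hθ]
  have hnn : ∀ z : Finset ι × (ι → Bool), 0 ≤ p ^ z.1.card := fun Q => pow_nonneg hp0 _
  induction t with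
  | zero => intro y; simp [Out]
  | succ t ih =>
    intro y
    simp only [Out]
    set E := ((Fintype.card κ : ℝ) * θ ^ (w' + 1)) ^ t with hE
    have hE0 : 0 ≤ E := by positivity
    refine (sum_biUnion_le' _ _ _ hnn).trans ?_
    have step : ∀ i ∈ (univ : Finset κ), ∑ z ∈ ((RO (τ i) (w' + 1) y).filter
      (fun Q => w' < Q.card)).biUnion fun Q =>
        Q.powerset.biUnion fun A =>
          ((Out τ w' t (ow Q (ind A) y)).filter (fun z => Disjoint Q z.1)).image
            (fun z => (Q ∪ z.1, z.2)), p ^ z.1.card ≤ θ ^ (w' + 1) * E := by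
      intro i _
      refine (sum_biUnion_le' _ _ _ hnn).trans ?_
      have s2 : ∀ Q ∈ (RO (τ i) (w' + 1) y).filter (fun Q => w' < Q.card),
          ∑ z ∈ Q.powerset.biUnion fun A =>
          ((Out τ w' t (ow Q (ind A) y)).filter (fun z => Disjoint Q z.1)).image
            (fun z => (Q ∪ z.1, z.2)), p ^ z.1.card ≤ ζ ^ Q.card * (θ ^ (w' + 1) * E) := by
        intro Q hQ
        have hQc := (mem_filter.mp hQ).2
        refine (sum_biUnion_le' _ _ _ hnn).trans ?_
        have s3 : ∀ A ∈ Q.powerset, ∑ z ∈ ((Out τ w' t (ow Q (ind A) y)).filter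
            (fun z => Disjoint Q z.1)).image (fun z => (Q ∪ z.1, z.2)), p ^ z.1.card
            ≤ p ^ Q.card * E := by
          intro A _
          refine (sum_image_le' _ _ _ hnn).trans ?_
          calc ∑ z ∈ (Out τ w' t (ow Q (ind A) y)).filter (fun z => Disjoint Q z.1),
                p ^ (Q ∪ z.1).card
              = ∑ z ∈ (Out τ w' t (ow Q (ind A) y)).filter (fun z => Disjoint Q z.1),
                p ^ Q.card * p ^ z.1.card := by
                apply sum_congr rfl
                intro z hz
                rw [card_union_of_disjoint (mem_filter.mp hz).2, pow_add]
            _ = p ^ Q.card * ∑ z ∈ (Out τ w' t (ow Q (ind A) y)).filter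
                  (fun z => Disjoint Q z.1), p ^ z.1.card := by rw [mul_sum]
            _ ≤ p ^ Q.card * E := by
                apply mul_le_mul_of_nonneg_left _ (pow_nonneg hp0 _)
                refine le_trans ?_ (ih (ow Q (ind A) y))
                exact sum_le_sum_of_subset_of_nonneg (filter_subset _ _) fun b _ _ => hnn b
        refine (sum_le_sum s3).trans ?_
        rw [sum_const, card_powerset, nsmul_eq_mul]
        push_cast
        have e : (2 : ℝ) ^ Q.card * (p ^ Q.card * E) = ζ ^ Q.card * (θ ^ Q.card * E) := by
          rw [← mul_assoc, ← mul_pow, hp, mul_pow]; ring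
        rw [e]
        apply mul_le_mul_of_nonneg_left _ (pow_nonneg hζ _)
        apply mul_le_mul_of_nonneg_right _ hE0
        exact pow_le_pow_of_le_one hθ hθ1 hQc
      refine (sum_le_sum s2).trans ?_
      rw [← sum_mul]
      have hR := RO_weight (τ i) w (hw i) ζ hζ h1 (w' + 1) y
      have h4 : ∑ Q ∈ (RO (τ i) (w' + 1) y).filter (fun Q => w' < Q.card), ζ ^ Q.card ≤ 1 :=
        le_trans (sum_le_sum_of_subset_of_nonneg (filter_subset _ _)
          fun b _ _ => pow_nonneg hζ _) hR
      have h5 : 0 ≤ θ ^ (w' + 1) * E := by positivity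
      nlinarith
    refine (sum_le_sum step).trans ?_
    rw [sum_const, nsmul_eq_mul, card_univ, pow_succ _ t, ← hE]
    apply le_of_eq; ring

/-- `Q` is a legal set of variables to be queried in the current round. -/
def RoundOK (τ : κ → List (Term ι)) (w w' : ℕ) (S : Finset ι) (x : ι → Bool)
    (Q : Finset ι) : Prop :=
  Q ⊆ S ∧ w' < Q.card ∧ Q.card ≤ w' + w ∧ ∃ (i : κ) (σ : ι → Bool),
    ∀ y, AgOff S x y → (∀ j ∈ Q, y j = σ j) → Q ∈ RO (τ i) (w' + 1) y

open Classical in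
noncomputable def roundQ (τ : κ → List (Term ι)) (w w' : ℕ) (S : Finset ι) (x : ι → Bool) :
    Finset ι :=
  if h : ∃ Q, RoundOK τ w w' S x Q then h.choose else ∅

theorem roundQ_congr (τ : κ → List (Term ι)) (w w' : ℕ) (S : Finset ι) {x x' : ι → Bool}
    (h : AgOff S x x') : roundQ τ w w' S x = roundQ τ w w' S x' := by
  have : RoundOK τ w w' S x = RoundOK τ w w' S x' := by
    funext Q
    have : ∀ y, AgOff S x y ↔ AgOff S x' y := fun y => ⟨h.symm.trans, h.trans⟩
    simp only [RoundOK, this]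
  unfold roundQ
  rw [this]

theorem roundQ_subset (τ : κ → List (Term ι)) (w w' : ℕ) (S : Finset ι) (x : ι → Bool) :
    roundQ τ w w' S x ⊆ S := by
  unfold roundQ
  split
  · next h => exact h.choose_spec.1
  · simp

theorem roundQ_card (τ : κ → List (Term ι)) (w w' : ℕ) (S : Finset ι) (x : ι → Bool) :
    (roundQ τ w w' S x).card ≤ w' + w := by
  unfold roundQ
  split
  · next h => exact h.choose_spec.2.2.1
  · simp

noncomputable def walk (τ : κ → List (Term ι)) (w w' : ℕ) : ℕ → Finset ι → (ι → Bool) → Finset ι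
  | 0, S, _ => S
  | t + 1, S, x => walk τ w w' t (S \ roundQ τ w w' S x) x

theorem walk_subset (τ : κ → List (Term ι)) (w w' t : ℕ) : ∀ (S : Finset ι) (x : ι → Bool),
    walk τ w w' t S x ⊆ S := by
  induction t with
  | zero => intro S x; exact Subset.refl _
  | succ t ih => intro S x; exact (ih _ _).trans sdiff_subset

theorem walk_card (τ : κ → List (Term ι)) (w w' t : ℕ) : ∀ (S : Finset ι) (x : ι → Bool),
    (S \ walk τ w w' t S x).card ≤ t * (w' + w) := by
  induction t with
  | zero => intro S x; simp [walk]
  | succ t ih =>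
    intro S x
    simp only [walk]
    have h1 := ih (S \ roundQ τ w w' S x) x
    have h2 := roundQ_card τ w w' S x
    have h3 : S \ walk τ w w' t (S \ roundQ τ w w' S x) x ⊆ roundQ τ w w' S x ∪
      ((S \ roundQ τ w w' S x) \ walk τ w w' t (S \ roundQ τ w w' S x) x) := by
      intro i hi
      simp only [mem_union, mem_sdiff] at hi ⊢
      tauto
    have h4 := (card_le_card h3).trans (card_union_le _ _)
    rw [Nat.succ_mul]
    omega

theorem walk_congr (τ : κ → List (Term ι)) (w w' t : ℕ) : ∀ (S : Finset ι) (x x' : ι → Bool),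
    AgOff (walk τ w w' t S x) x x' → walk τ w w' t S x' = walk τ w w' t S x := by
  induction t with
  | zero => intro S x x' _; rfl
  | succ t ih =>
    intro S x x' h
    have h1 : AgOff S x x' := h.mono (walk_subset _ _ _ _ _ _)
    simp only [walk] at h ⊢
    rw [← roundQ_congr τ w w' S h1]
    exact ih _ _ _ h

theorem walk_cover (τ : κ → List (Term ι)) (w w' : ℕ) (hw : ∀ i, ∀ T ∈ τ i, T.1.card ≤ w)
    (t : ℕ) : ∀ (S : Finset ι) (x : ι → Bool),
    (¬ ∀ i, Simple w' (dnf (τ i)) (walk τ w w' t S x) x) →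
    ∃ (Q : Finset ι) (x0 : ι → Bool), Q ⊆ S ∧ AgOff Q x x0 ∧ (Q, x) ∈ Out τ w' t x0 := by
  induction t with
  | zero =>
    intro S x _
    exact ⟨∅, x, by simp, AgOff.rfl' _ _, by simp [Out]⟩
  | succ t ih =>
    intro S x h
    have hex : ∃ Q, RoundOK τ w w' S x Q := by
      push Not at h
      obtain ⟨i, hi⟩ := h
      have hns : ¬ Simple w' (dnf (τ i)) S x := fun hs =>
        hi (hs.mono (walk_subset _ _ _ _ _ _) le_rfl)
      obtain ⟨Q, σ, a, b, c, e⟩ := round_exists (τ i) w (hw i) (w' + 1) w' S x (by omega) hns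
      exact ⟨Q, a, b, c, i, σ, e⟩
    have hQ : RoundOK τ w w' S x (roundQ τ w w' S x) := by
      unfold roundQ
      rw [dif_pos hex]
      exact hex.choose_spec
    simp only [walk] at h
    set Q1 := roundQ τ w w' S x
    obtain ⟨Q2, x0', hQ2, hag, hout⟩ := ih _ _ h
    obtain ⟨hQ1S, hQ1c, _, i, σ, hRO⟩ := hQ
    have hdisj : Disjoint Q1 Q2 := by
      rw [disjoint_left]
      intro j hj hj'
      exact (mem_sdiff.mp (hQ2 hj')).2 hj
    refine ⟨Q1 ∪ Q2, ow Q1 σ x0', union_subset hQ1S (hQ2.trans sdiff_subset), ?_, ?_⟩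
    · intro j hj
      simp only [mem_union, not_or] at hj
      simp only [ow, hj.1, if_false]
      exact hag j hj.2
    · simp only [Out, mem_biUnion, mem_univ, true_and, mem_filter, mem_powerset, mem_image]
      refine ⟨i, Q1, ⟨?_, hQ1c⟩, Q1.filter (fun j => x j = true), filter_subset _ _, (Q2, x), ?_, rfl⟩
      · apply hRO
        · intro j hj
          have h1 : j ∉ Q1 := fun h => hj (hQ1S h)
          have h2 : j ∉ Q2 := fun h => hj (mem_sdiff.mp (hQ2 h)).1
          simp only [ow, h1, if_false]
          exact hag j h2
        · intro j hj; simp [ow, hj]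
      · refine ⟨?_, hdisj⟩
        convert hout using 2
        funext j
        by_cases hj : j ∈ Q1
        · have h2 : j ∉ Q2 := disjoint_left.mp hdisj hj
          simp only [ow, hj, if_true, ind, mem_filter, true_and]
          rw [← hag j h2]
          simp
        · simp [ow, hj]

/-! ### random subsets -/

theorem subset_sum_prod (p : ℝ) (g : ι → Bool → ℝ) :
    ∑ L : ι → Bool, subsetDensity p L * ∏ i, g i (L i) =
      ∏ i, (p * g i true + (1 - p) * g i false) := by
  have : ∀ i, p * g i true + (1 - p) * g i false =
      ∑ b : Bool, (if b then p else 1 - p) * g i b := by intro i; simp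
  simp only [this]
  rw [Fintype.prod_sum]
  apply sum_congr rfl
  intro L _
  rw [subsetDensity, prod_mul_distrib]

theorem subsetDensity_nonneg (p : ℝ) (h0 : 0 ≤ p) (h1 : p ≤ 1) (L : ι → Bool) :
    0 ≤ subsetDensity p L := by
  apply prod_nonneg
  intro i _
  split <;> linarith

theorem subset_sum_one (p : ℝ) : ∑ L : ι → Bool, subsetDensity p L = 1 := by
  have := subset_sum_prod (ι := ι) p (fun _ _ => 1)
  simpa using this

theorem subset_sum_superset (p : ℝ) (Q : Finset ι) :
    ∑ L : ι → Bool, subsetDensity p L * (if ∀ i ∈ Q, L i = true then 1 else 0) = p ^ Q.card := by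
  have := subset_sum_prod (ι := ι) p (fun i b => if i ∈ Q then (if b then 1 else 0) else 1)
  have e1 : ∀ L : ι → Bool, (∏ i, (if i ∈ Q then (if L i then (1 : ℝ) else 0) else 1)) =
      (if ∀ i ∈ Q, L i = true then 1 else 0) := by
    intro L
    rw [Finset.prod_ite_mem univ Q, univ_inter]
    split
    · next h => exact prod_eq_one fun i hi => by simp [h i hi]
    · next h =>
      push Not at h
      obtain ⟨i, hi, hL⟩ := h
      exact prod_eq_zero hi (by simp [hL])
  simp only [e1] at this
  rw [this]
  refine (prod_congr rfl (g := fun i => if i ∈ Q then p else 1) (fun i _ => ?_)).trans ?_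
  · by_cases hi : i ∈ Q <;> simp [hi]
  rw [Finset.prod_ite_mem univ Q, univ_inter, prod_const]

/-- free variables after intersecting with `L`. -/
def cut (S : Finset ι) (L : ι → Bool) : Finset ι := S.filter (fun i => L i = true)

open Classical in
/-- **The multi-switching bound for one stage.** -/
theorem stage_bound (τ : (ι → Bool) → κ → List (Term ι)) (S0 : (ι → Bool) → Finset ι) (w w' : ℕ)
    (hinv : ∀ x y, AgOff (S0 x) x y → τ y = τ x)
    (hw : ∀ x i, ∀ T ∈ τ x i, T.1.card ≤ w)
    (ζ θ p : ℝ) (hζ : 0 ≤ ζ) (hθ : 0 ≤ θ) (hθ1 : θ ≤ 1) (hp : 2 * p = ζ * θ) (hp1 : p ≤ 1)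
    (h1 : (1 + 2 * ζ) ^ w ≤ 3 / 2) (t : ℕ) :
    (∑ L : ι → Bool, subsetDensity p L * ((Finset.univ.filter fun x : ι → Bool =>
      ∃ Q ⊆ cut (S0 x) L, ∃ x0, AgOff Q x x0 ∧ (Q, x) ∈ Out (τ x) w' t x0).card : ℝ)) ≤
      ((Fintype.card κ : ℝ) * θ ^ (w' + 1)) ^ t * 2 ^ Fintype.card ι := by
  have hp0 : 0 ≤ p := by nlinarith [mul_nonneg hζ hθ]
  have hc : ∀ L : ι → Bool, ((Finset.univ.filter fun x : ι → Bool =>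
      ∃ Q ⊆ cut (S0 x) L, ∃ x0, AgOff Q x x0 ∧ (Q, x) ∈ Out (τ x) w' t x0).card : ℝ) ≤
      ∑ x0 : ι → Bool, ∑ z ∈ Out (τ x0) w' t x0, if ∀ i ∈ z.1, L i = true then (1 : ℝ) else 0 := by
    intro L
    have hsub : (Finset.univ.filter fun x : ι → Bool =>
      ∃ Q ⊆ cut (S0 x) L, ∃ x0, AgOff Q x x0 ∧ (Q, x) ∈ Out (τ x) w' t x0) ⊆
      (univ : Finset (ι → Bool)).biUnion fun x0 => ((Out (τ x0) w' t x0).filter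
        (fun z => ∀ i ∈ z.1, L i = true)).image (fun z => z.2) := by
      intro x hx
      obtain ⟨Q, hQ, x0, hag, ho⟩ := (mem_filter.mp hx).2
      simp only [mem_biUnion, mem_univ, true_and, mem_image, mem_filter]
      refine ⟨x0, (Q, x), ⟨?_, ?_⟩, rfl⟩
      · rw [hinv x x0 (hag.mono (hQ.trans (filter_subset _ _)))]; exact ho
      · intro i hi; exact (mem_filter.mp (hQ hi)).2
    have h2 := (card_le_card hsub).trans card_biUnion_le
    have h3 : ∑ x0 : ι → Bool, (((Out (τ x0) w' t x0).filter
        (fun z => ∀ i ∈ z.1, L i = true)).image (fun z => z.2)).card ≤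
        ∑ x0 : ι → Bool, ((Out (τ x0) w' t x0).filter
        (fun z => ∀ i ∈ z.1, L i = true)).card := sum_le_sum fun _ _ => card_image_le
    have h4 : ((∑ x0 : ι → Bool, ((Out (τ x0) w' t x0).filter
        (fun z => ∀ i ∈ z.1, L i = true)).card : ℕ) : ℝ) =
        ∑ x0 : ι → Bool, ∑ z ∈ Out (τ x0) w' t x0, if ∀ i ∈ z.1, L i = true then (1 : ℝ) else 0 := by
      push_cast
      apply sum_congr rfl
      intro x0 _
      rw [sum_boole]
    rw [← h4]
    exact_mod_cast h2.trans h3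
  calc _ ≤ ∑ L : ι → Bool, subsetDensity p L * ∑ x0 : ι → Bool, ∑ z ∈ Out (τ x0) w' t x0,
            (if ∀ i ∈ z.1, L i = true then (1 : ℝ) else 0) :=
        sum_le_sum fun L _ => mul_le_mul_of_nonneg_left (hc L) (subsetDensity_nonneg p hp0 hp1 L)
    _ = ∑ x0 : ι → Bool, ∑ z ∈ Out (τ x0) w' t x0, p ^ z.1.card := by
        simp only [mul_sum]
        rw [sum_comm]
        apply sum_congr rfl
        intro x0 _
        rw [sum_comm]
        apply sum_congr rfl
        intro z _
        exact subset_sum_superset p z.1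
    _ ≤ ∑ x0 : ι → Bool, ((Fintype.card κ : ℝ) * θ ^ (w' + 1)) ^ t :=
        sum_le_sum fun x0 _ => Out_weight (τ x0) w w' (hw x0) ζ θ p hζ hθ hθ1 hp h1 t x0
    _ = _ := by
        rw [sum_const, nsmul_eq_mul, card_univ, mul_comm]
        simp

end SwL

namespace SwL

set_option linter.unusedSectionVars false

variable {ι : Type} [Fintype ι] [DecidableEq ι]

/-- A randomized adaptive process producing a set of free variables. -/
structure Proc (ι : Type) [Fintype ι] [DecidableEq ι] where
  Λ : Type
  fin : Fintype Λ
  μ : Λ → ℝ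
  μ0 : ∀ l, 0 ≤ μ l
  μ1 : ∑ l, μ l = 1
  star : Λ → ι → Bool
  S : Λ → (ι → Bool) → Finset ι
  closed : ∀ l x y, AgOff (S l x) x y → S l y = S l x
  P : ℝ
  law : ∀ g : ι → Bool → ℝ, ∑ l, μ l * ∏ i, g i (star l i) =
    ∏ i, (P * g i true + (1 - P) * g i false)

attribute [instance] Proc.fin

open Classical in
/-- weight of an event (times `2^n`). -/
noncomputable def Proc.cnt (A : Proc ι) (E : A.Λ → (ι → Bool) → Prop) : ℝ :=
  ∑ l, A.μ l * ((Finset.univ.filter fun x => E l x).card : ℝ)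

theorem Proc.cnt_mono (A : Proc ι) {E F : A.Λ → (ι → Bool) → Prop} (h : ∀ l x, E l x → F l x) :
    A.cnt E ≤ A.cnt F := by
  classical
  unfold Proc.cnt
  apply sum_le_sum
  intro l _
  apply mul_le_mul_of_nonneg_left _ (A.μ0 l)
  have : (Finset.univ.filter fun x => E l x) ⊆ (Finset.univ.filter fun x => F l x) := by
    intro x hx
    simp only [mem_filter, mem_univ, true_and] at hx ⊢
    exact h l x hx
  exact_mod_cast card_le_card this

theorem Proc.cnt_or (A : Proc ι) (E F : A.Λ → (ι → Bool) → Prop) :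
    A.cnt (fun l x => E l x ∨ F l x) ≤ A.cnt E + A.cnt F := by
  classical
  unfold Proc.cnt
  rw [← sum_add_distrib]
  apply sum_le_sum
  intro l _
  rw [← mul_add]
  apply mul_le_mul_of_nonneg_left _ (A.μ0 l)
  have : (Finset.univ.filter fun x => E l x ∨ F l x) ⊆
      (Finset.univ.filter fun x => E l x) ∪ (Finset.univ.filter fun x => F l x) := by
    intro x hx
    simpa using hx
  have h2 := (card_le_card this).trans (card_union_le _ _)
  have h3 : ((Finset.univ.filter fun x => E l x ∨ F l x).card : ℝ) ≤
      ((Finset.univ.filter fun x => E l x).card : ℝ) +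
      ((Finset.univ.filter fun x => F l x).card : ℝ) := by exact_mod_cast h2
  refine le_trans (le_of_eq ?_) h3
  congr!

theorem Proc.cnt_compl (A : Proc ι) (E : A.Λ → (ι → Bool) → Prop) :
    A.cnt E + A.cnt (fun l x => ¬ E l x) = 2 ^ Fintype.card ι := by
  classical
  unfold Proc.cnt
  rw [← sum_add_distrib]
  calc _ = ∑ l, A.μ l * 2 ^ Fintype.card ι := by
        apply sum_congr rfl
        intro l _
        rw [← mul_add]
        congr 1
        have := card_filter_add_card_filter_not (s := (univ : Finset (ι → Bool))) (fun x => E l x)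
        have h2 : (univ : Finset (ι → Bool)).card = 2 ^ Fintype.card ι := by simp
        rw [h2] at this
        convert congrArg (fun n : ℕ => (n : ℝ)) this using 1
        · push_cast
          congr!
        · push_cast
          rfl
    _ = _ := by rw [← sum_mul, A.μ1, one_mul]

/-- the trivial process. -/
def Proc.triv (ι : Type) [Fintype ι] [DecidableEq ι] : Proc ι where
  Λ := Unit
  fin := inferInstance
  μ := fun _ => 1
  μ0 := by simp
  μ1 := by simp
  star := fun _ _ => true
  S := fun _ _ => univ
  closed := by intros; rfl
  P := 1
  law := by intro g; simp

/-- star variables that were queried. -/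
def Proc.lost (A : Proc ι) (l : A.Λ) (x : ι → Bool) : Finset ι :=
  (univ.filter fun i => A.star l i = true) \ A.S l x

/-- small 1-certificates on a cube. -/
def HasCert (w : ℕ) (f : (ι → Bool) → Bool) (S : Finset ι) (x : ι → Bool) : Prop :=
  ∀ y, AgOff S x y → f y = true → ∃ V : Finset ι, V.card ≤ w ∧
    ∀ z, AgOff S x z → (∀ i ∈ V, z i = y i) → f z = true

open Classical in
noncomputable def certs (w : ℕ) (f : (ι → Bool) → Bool) (S : Finset ι) (x : ι → Bool) :
    List (Term ι) :=
  (univ.filter fun T : Term ι => T.1.card ≤ w ∧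
    ∀ z, AgOff S x z → sat z T = true → f z = true).toList

theorem AgOff_iff {S : Finset ι} {x x' : ι → Bool} (h : AgOff S x x') :
    AgOff S x = AgOff S x' := by
  funext y
  exact propext ⟨h.symm.trans, h.trans⟩

theorem certs_congr (w : ℕ) (f : (ι → Bool) → Bool) (S : Finset ι) {x x' : ι → Bool}
    (h : AgOff S x x') : certs w f S x = certs w f S x' := by
  unfold certs
  rw [AgOff_iff h]

theorem HasCert_congr (w : ℕ) (f : (ι → Bool) → Bool) (S : Finset ι) {x x' : ι → Bool}
    (h : AgOff S x x') : HasCert w f S x = HasCert w f S x' := by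
  unfold HasCert
  rw [AgOff_iff h]

theorem certs_width (w : ℕ) (f : (ι → Bool) → Bool) (S : Finset ι) (x : ι → Bool) :
    ∀ T ∈ certs w f S x, T.1.card ≤ w := by
  intro T hT
  simp only [certs, mem_toList, mem_filter] at hT
  exact hT.2.1

theorem certs_dnf (w : ℕ) (f : (ι → Bool) → Bool) (S : Finset ι) (x : ι → Bool)
    (h : HasCert w f S x) (y : ι → Bool) (hy : AgOff S x y) : f y = dnf (certs w f S x) y := by
  rw [Bool.eq_iff_iff]
  constructor
  · intro hf
    obtain ⟨V, hV, hc⟩ := h y hy hf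
    simp only [dnf, List.any_eq_true]
    refine ⟨(V, y), ?_, by simp [sat]⟩
    simp only [certs, mem_toList, mem_filter, mem_univ, true_and]
    refine ⟨hV, fun z hz hs => hc z hz ?_⟩
    simpa [sat] using hs
  · intro hd
    simp only [dnf, List.any_eq_true] at hd
    obtain ⟨T, hT, hs⟩ := hd
    simp only [certs, mem_toList, mem_filter, mem_univ, true_and] at hT
    exact hT.2 y hy hs

open Classical in
noncomputable def stTerms {κ : Type} (w : ℕ) (G : κ → (ι → Bool) → Bool) (S : Finset ι)
    (x : ι → Bool) (i : κ) : List (Term ι) :=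
  if HasCert w (G i) S x then certs w (G i) S x else certs w (fun y => !(G i y)) S x

theorem stTerms_congr {κ : Type} (w : ℕ) (G : κ → (ι → Bool) → Bool) (S : Finset ι)
    {x x' : ι → Bool} (h : AgOff S x x') : stTerms w G S x = stTerms w G S x' := by
  funext i
  unfold stTerms
  rw [HasCert_congr w _ S h, certs_congr w _ S h, certs_congr w _ S h]

theorem stTerms_width {κ : Type} (w : ℕ) (G : κ → (ι → Bool) → Bool) (S : Finset ι)
    (x : ι → Bool) (i : κ) : ∀ T ∈ stTerms w G S x i, T.1.card ≤ w := by
  unfold stTerms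
  split <;> exact certs_width _ _ _ _

theorem stTerms_simple {κ : Type} (w w' : ℕ) (G : κ → (ι → Bool) → Bool) (S S' : Finset ι)
    (hS : S' ⊆ S) (x : ι → Bool) (i : κ)
    (h : HasCert w (G i) S x ∨ HasCert w (fun y => !(G i y)) S x)
    (hs : Simple w' (dnf (stTerms w G S x i)) S' x) : Simple w' (G i) S' x := by
  unfold stTerms at hs
  split at hs
  · next hc => exact hs.congr_f fun y hy => certs_dnf w _ S x hc y (hy.mono hS)
  · next hc =>
    have h' : HasCert w (fun y => !(G i y)) S x := h.resolve_left hc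
    refine hs.neg.congr_f fun y hy => ?_
    rw [← certs_dnf w _ S x h' y (hy.mono hS)]
    simp

variable {κ : Type} [Fintype κ]

/-- one more stage. -/
noncomputable def Proc.ext (A : Proc ι) (G : κ → (ι → Bool) → Bool) (w w' t : ℕ) (p : ℝ)
    (hp0 : 0 ≤ p) (hp1 : p ≤ 1) : Proc ι where
  Λ := A.Λ × (ι → Bool)
  fin := inferInstance
  μ := fun l => A.μ l.1 * subsetDensity p l.2
  μ0 := fun l => mul_nonneg (A.μ0 _) (subsetDensity_nonneg p hp0 hp1 _)
  μ1 := by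
    rw [Fintype.sum_prod_type]
    simp only [← mul_sum, subset_sum_one, mul_one, A.μ1]
  star := fun l i => A.star l.1 i && l.2 i
  S := fun l x => walk (stTerms w G (A.S l.1 x) x) w w' t (cut (A.S l.1 x) l.2) x
  closed := by
    intro l x y h
    have hsub : walk (stTerms w G (A.S l.1 x) x) w w' t (cut (A.S l.1 x) l.2) x ⊆ A.S l.1 x :=
      (walk_subset _ _ _ _ _ _).trans (filter_subset _ _)
    have h1 := h.mono hsub
    rw [A.closed l.1 x y h1, ← stTerms_congr w G _ h1]
    exact walk_congr _ _ _ _ _ _ _ h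
  P := A.P * p
  law := by
    intro g
    rw [Fintype.sum_prod_type]
    have h1 : ∀ l, ∑ L : ι → Bool, A.μ l * subsetDensity p L * ∏ i, g i (A.star l i && L i) =
        A.μ l * ∏ i, (p * g i (A.star l i) + (1 - p) * g i false) := by
      intro l
      have := subset_sum_prod p (fun i b => g i (A.star l i && b))
      simp only [Bool.and_true, Bool.and_false] at this
      rw [← this, mul_sum]
      apply sum_congr rfl
      intro L _
      ring
    rw [sum_congr rfl fun l _ => h1 l]
    have h2 := A.law (fun i b => p * g i b + (1 - p) * g i false)
    rw [h2]
    apply prod_congr rfl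
    intro i _
    ring

theorem Proc.ext_bound (A : Proc ι) (G : κ → (ι → Bool) → Bool) (w w' t : ℕ) (p : ℝ)
    (hp0 : 0 ≤ p) (hp1 : p ≤ 1) (ζ θ : ℝ) (hζ : 0 ≤ ζ) (hθ : 0 ≤ θ) (hθ1 : θ ≤ 1)
    (hp : 2 * p = ζ * θ) (h1 : (1 + 2 * ζ) ^ w ≤ 3 / 2) (D : ℕ) :
    (A.ext G w w' t p hp0 hp1).cnt (fun l x => ¬ ((∀ i, Simple w' (G i)
        ((A.ext G w w' t p hp0 hp1).S l x) x) ∧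
        ((A.ext G w w' t p hp0 hp1).lost l x).card ≤ D + t * (w' + w))) ≤
      A.cnt (fun l x => ¬ ((∀ i, HasCert w (G i) (A.S l x) x ∨
        HasCert w (fun y => !(G i y)) (A.S l x) x) ∧ (A.lost l x).card ≤ D)) +
      ((Fintype.card κ : ℝ) * θ ^ (w' + 1)) ^ t * 2 ^ Fintype.card ι := by
  classical
  set B := A.ext G w w' t p hp0 hp1 with hB
  let old : A.Λ → (ι → Bool) → Prop := fun l x => ¬ ((∀ i, HasCert w (G i) (A.S l x) x ∨
        HasCert w (fun y => !(G i y)) (A.S l x) x) ∧ (A.lost l x).card ≤ D)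
  let cov : B.Λ → (ι → Bool) → Prop := fun l x => ∃ Q ⊆ cut (A.S l.1 x) l.2, ∃ x0,
    AgOff Q x x0 ∧ (Q, x) ∈ Out (stTerms w G (A.S l.1 x) x) w' t x0
  have hpt : ∀ (l : B.Λ) (x : ι → Bool), ¬ ((∀ i, Simple w' (G i) (B.S l x) x) ∧
      (B.lost l x).card ≤ D + t * (w' + w)) → (old l.1 x ∨ cov l x) := by
    intro l x hbad
    by_contra hcon
    obtain ⟨hold', hcov⟩ := not_or.mp hcon
    have hold := not_not.mp hold'
    apply hbad
    have hSsub : B.S l x ⊆ A.S l.1 x :=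
      (walk_subset _ _ _ _ _ _).trans (filter_subset _ _)
    constructor
    · have hall : ∀ i, Simple w' (dnf (stTerms w G (A.S l.1 x) x i)) (B.S l x) x := by
        by_contra hns
        obtain ⟨Q, x0, a, b, c⟩ := walk_cover (stTerms w G (A.S l.1 x) x) w w'
          (stTerms_width w G _ _) t (cut (A.S l.1 x) l.2) x hns
        exact hcov ⟨Q, a, x0, b, c⟩
      intro i
      exact stTerms_simple w w' G _ _ hSsub x i (hold.1 i) (hall i)
    · have hsub : B.lost l x ⊆ A.lost l.1 x ∪ (cut (A.S l.1 x) l.2 \ B.S l x) := by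
        intro i hi
        simp only [Proc.lost, mem_sdiff, mem_filter, mem_univ, true_and, mem_union, cut] at hi ⊢
        have h2 : A.star l.1 i = true ∧ l.2 i = true := by
          have : (A.star l.1 i && l.2 i) = true := hi.1
          simpa using this
        by_cases hiS : i ∈ A.S l.1 x
        · exact Or.inr ⟨⟨hiS, h2.2⟩, hi.2⟩
        · exact Or.inl ⟨h2.1, hiS⟩
      have h3 := (card_le_card hsub).trans (card_union_le _ _)
      have h4 : (cut (A.S l.1 x) l.2 \ B.S l x).card ≤ t * (w' + w) := walk_card _ _ _ _ _ _
      have := hold.2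
      omega
  refine (B.cnt_mono hpt).trans ((B.cnt_or _ _).trans ?_)
  apply add_le_add
  · apply le_of_eq
    unfold Proc.cnt
    change ∑ l : A.Λ × (ι → Bool), A.μ l.1 * subsetDensity p l.2 * _ = _
    rw [Fintype.sum_prod_type]
    apply sum_congr rfl
    intro l _
    simp only
    rw [← sum_mul, ← mul_sum, subset_sum_one, mul_one]
  · unfold Proc.cnt
    change ∑ l : A.Λ × (ι → Bool), A.μ l.1 * subsetDensity p l.2 * _ ≤ _
    rw [Fintype.sum_prod_type]
    have hl : ∀ l ∈ (univ : Finset A.Λ), ∑ L : ι → Bool, A.μ l * subsetDensity p L *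
        ((Finset.univ.filter fun x => cov (l, L) x).card : ℝ) ≤
        A.μ l * (((Fintype.card κ : ℝ) * θ ^ (w' + 1)) ^ t * 2 ^ Fintype.card ι) := by
      intro l _
      have := stage_bound (fun x => stTerms w G (A.S l x) x) (fun x => A.S l x) w w'
        (fun x y h => by
          rw [A.closed l x y h, stTerms_congr w G _ h])
        (fun x i => stTerms_width w G _ _ i) ζ θ p hζ hθ hθ1 hp hp1 h1 t
      refine le_trans (le_of_eq ?_) (mul_le_mul_of_nonneg_left this (A.μ0 l))
      rw [mul_sum]
      apply sum_congr rfl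
      intro L _
      rw [mul_assoc]
    have hl2 := sum_le_sum hl
    have e3 : ∑ l, A.μ l * (((Fintype.card κ : ℝ) * θ ^ (w' + 1)) ^ t * 2 ^ Fintype.card ι) =
        ((Fintype.card κ : ℝ) * θ ^ (w' + 1)) ^ t * 2 ^ Fintype.card ι := by
      rw [← sum_mul, A.μ1, one_mul]
    rw [e3] at hl2
    refine le_trans (le_of_eq ?_) hl2
    apply sum_congr rfl
    intro l _
    apply sum_congr rfl
    intro L _
    congr!

/-- probability that a given set of variables contains no star. -/
theorem Proc.empty_prob (A : Proc ι) (U : Finset ι) :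
    ∑ l, A.μ l * (if ∀ i ∈ U, A.star l i = false then 1 else 0) = (1 - A.P) ^ U.card := by
  have := A.law (fun i b => if i ∈ U then (if b then 0 else 1) else 1)
  have e1 : ∀ l, (∏ i, (if i ∈ U then (if A.star l i then (0 : ℝ) else 1) else 1)) =
      (if ∀ i ∈ U, A.star l i = false then 1 else 0) := by
    intro l
    rw [Finset.prod_ite_mem univ U, univ_inter]
    split
    · next h => exact prod_eq_one fun i hi => by simp [h i hi]
    · next h =>
      push Not at h
      obtain ⟨i, hi, hL⟩ := h
      exact prod_eq_zero hi (by simp at hL; simp [hL])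
  simp only [e1] at this
  rw [this]
  refine (prod_congr rfl (g := fun i => if i ∈ U then (1 - A.P) else 1) (fun i _ => ?_)).trans ?_
  · by_cases hi : i ∈ U <;> simp [hi]
  rw [Finset.prod_ite_mem univ U, univ_inter, prod_const]

end SwL

namespace SwL

set_option linter.unusedSectionVars false

variable {ι : Type} [Fintype ι] [DecidableEq ι]

/-! ### fairness -/

def rho (S : Finset ι) (x : ι → Bool) : ι → Option Bool := fun i => if i ∈ S then none else some (x i)

noncomputable def Proc.R (A : Proc ι) (ρ : ι → Option Bool) : ℝ :=
  ∑ l, A.μ l * ((∑ x : ι → Bool, if rho (A.S l x) x = ρ then (1 : ℝ) else 0) / 2 ^ Fintype.card ι)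

theorem Proc.R_sum (A : Proc ι) (h : (ι → Option Bool) → ℝ) :
    ∑ ρ, A.R ρ * h ρ =
      ∑ l, A.μ l * ((∑ x : ι → Bool, h (rho (A.S l x) x)) / 2 ^ Fintype.card ι) := by
  unfold Proc.R
  simp only [sum_mul]
  rw [sum_comm]
  apply sum_congr rfl
  intro l _
  simp only [mul_assoc]
  rw [← mul_sum]
  congr 1
  simp only [div_mul_eq_mul_div, sum_mul, ← sum_div]
  congr 1
  rw [sum_comm]
  apply sum_congr rfl
  intro x _
  simp

theorem AgOff_card (S : Finset ι) (x : ι → Bool) [DecidablePred (AgOff S x)] :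
    (univ.filter fun y => AgOff S x y).card = 2 ^ S.card := by
  have : (univ.filter fun y => AgOff S x y) =
      Fintype.piFinset (fun i => if i ∈ S then (univ : Finset Bool) else {x i}) := by
    ext y
    rw [mem_filter, Fintype.mem_piFinset]
    simp only [mem_univ, true_and]
    unfold AgOff
    apply forall_congr'
    intro i
    by_cases hi : i ∈ S
    · simp [hi]
    · simp only [hi, not_false_eq_true, forall_true_left, if_false, mem_singleton]
      exact eq_comm
  rw [this, Fintype.card_piFinset]
  have h2 : ∀ i, (if i ∈ S then (univ : Finset Bool) else {x i}).card = if i ∈ S then 2 else 1 := by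
    intro i; split <;> simp
  rw [prod_congr rfl fun i _ => h2 i, Finset.prod_ite_mem univ S, univ_inter, prod_const]

theorem freeCount_rho (S : Finset ι) (x : ι → Bool) : freeCount (rho S x) = S.card := by
  unfold freeCount rho
  congr 1
  ext i
  simp

theorem applyR_rho (S : Finset ι) (x y : ι → Bool) : applyR (rho S x) y = ow S y x := by
  funext i
  by_cases hi : i ∈ S <;> simp [applyR, rho, ow, hi]

theorem Proc.fair (A : Proc ι) : IsFair A.R := by
  classical
  have hpos : (0 : ℝ) < 2 ^ Fintype.card ι := by positivity
  refine ⟨?_, ?_, ?_⟩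
  · intro ρ
    unfold Proc.R
    refine sum_nonneg fun l _ => mul_nonneg (A.μ0 l) (div_nonneg (sum_nonneg fun x _ => ?_) hpos.le)
    split <;> norm_num
  · have := A.R_sum (fun _ => 1)
    simp only [mul_one] at this
    rw [this]
    have e : (∑ _x : ι → Bool, (1 : ℝ)) / 2 ^ Fintype.card ι = 1 := by
      simp
    simp only [e, mul_one, A.μ1]
  · intro x
    rw [A.R_sum]
    have key : ∀ l, (∑ x' : ι → Bool, if applyR (rho (A.S l x') x') x = x then
        ((1 : ℝ) / 2) ^ freeCount (rho (A.S l x') x') else 0) = 1 := by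
      intro l
      have h1 : ∀ x', (applyR (rho (A.S l x') x') x = x) ↔ AgOff (A.S l x') x' x := by
        intro x'
        rw [applyR_rho]
        constructor
        · intro h i hi
          have := congrFun h i
          simpa [ow, hi] using this
        · intro h
          funext i
          by_cases hi : i ∈ A.S l x'
          · simp [ow, hi]
          · simp [ow, hi, h i hi]
      have h2 : ∀ x', (if applyR (rho (A.S l x') x') x = x then
        ((1 : ℝ) / 2) ^ freeCount (rho (A.S l x') x') else 0) =
          if AgOff (A.S l x) x x' then ((1 : ℝ) / 2) ^ (A.S l x).card else 0 := by
        intro x'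
        rw [freeCount_rho]
        by_cases h : AgOff (A.S l x') x' x
        · have hS := A.closed l x' x h
          rw [if_pos ((h1 x').2 h), hS, if_pos h.symm]
        · rw [if_neg (fun h' => h ((h1 x').1 h')), if_neg]
          intro h'
          apply h
          rw [A.closed l x x' h']
          exact h'.symm
      rw [sum_congr rfl fun x' _ => h2 x', ← sum_filter, sum_const, AgOff_card, nsmul_eq_mul]
      push_cast
      rw [← mul_pow]
      norm_num
    simp only [key]
    rw [← sum_mul, A.μ1]
    simp

theorem Proc.prOf_R (A : Proc ι) (E : (ι → Option Bool) → Prop) :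
    prOf A.R E = A.cnt (fun l x => E (rho (A.S l x) x)) / 2 ^ Fintype.card ι := by
  classical
  have h1 : prOf A.R E = ∑ ρ, A.R ρ * (if E ρ then 1 else 0) := by
    unfold prOf
    apply sum_congr rfl
    intro ρ _
    split <;> simp
  rw [h1, A.R_sum]
  unfold Proc.cnt
  rw [sum_div]
  apply sum_congr rfl
  intro l _
  rw [mul_div_assoc]
  congr 2
  rw [sum_boole]

/-! ### circuits -/

def subs : AC0 ι → List (AC0 ι)
  | .lit i b => [.lit i b]
  | .and a f => .and a f :: (List.ofFn fun j => subs (f j)).flatten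
  | .or a f => .or a f :: (List.ofFn fun j => subs (f j)).flatten

theorem subs_length (C : AC0 ι) : (subs C).length = C.size := by
  induction C with
  | lit i b => rfl
  | and a f ih =>
    simp only [subs, List.length_cons, List.length_flatten, List.map_ofFn, AC0.size, List.sum_ofFn,
      Function.comp_def, ih]
    omega
  | or a f ih =>
    simp only [subs, List.length_cons, List.length_flatten, List.map_ofFn, AC0.size, List.sum_ofFn,
      Function.comp_def, ih]
    omega

theorem self_mem_subs (C : AC0 ι) : C ∈ subs C := by
  cases C <;> simp [subs]

/-- a predicate: the set of circuits is closed under taking children. -/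
def ChildClosed (s : AC0 ι → Prop) : Prop :=
  (∀ a f, s (.and a f) → ∀ j, s (f j)) ∧ (∀ a f, s (.or a f) → ∀ j, s (f j))

theorem subs_closed (C : AC0 ι) : ChildClosed (fun D => D ∈ subs C) := by
  induction C with
  | lit i b => constructor <;> · intro a f h; simp [subs] at h
  | and a f ih =>
    constructor
    · intro a' f' h j
      simp only [subs, List.mem_cons, List.mem_flatten, List.mem_ofFn] at h ⊢
      right
      rcases h with h | ⟨l, ⟨j', rfl⟩, h⟩
      · cases h
        exact ⟨_, ⟨j, rfl⟩, self_mem_subs _⟩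
      · exact ⟨_, ⟨j', rfl⟩, (ih j').1 _ _ h j⟩
    · intro a' f' h j
      simp only [subs, List.mem_cons, List.mem_flatten, List.mem_ofFn] at h ⊢
      right
      rcases h with h | ⟨l, ⟨j', rfl⟩, h⟩
      · cases h
      · exact ⟨_, ⟨j', rfl⟩, (ih j').2 _ _ h j⟩
  | or a f ih =>
    constructor
    · intro a' f' h j
      simp only [subs, List.mem_cons, List.mem_flatten, List.mem_ofFn] at h ⊢
      right
      rcases h with h | ⟨l, ⟨j', rfl⟩, h⟩
      · cases h
      · exact ⟨_, ⟨j', rfl⟩, (ih j').1 _ _ h j⟩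
    · intro a' f' h j
      simp only [subs, List.mem_cons, List.mem_flatten, List.mem_ofFn] at h ⊢
      right
      rcases h with h | ⟨l, ⟨j', rfl⟩, h⟩
      · cases h
        exact ⟨_, ⟨j, rfl⟩, self_mem_subs _⟩
      · exact ⟨_, ⟨j', rfl⟩, (ih j').2 _ _ h j⟩

theorem dt_cert (T : DTree ι Bool) (y : ι → Bool) : ∃ V : Finset ι, V.card ≤ T.depth ∧
    ∀ z, (∀ i ∈ V, z i = y i) → evalDT T z = evalDT T y := by
  induction T with
  | leaf b => exact ⟨∅, by simp, fun z _ => rfl⟩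
  | node i a b iha ihb =>
    obtain ⟨Va, ha, ha'⟩ := iha
    obtain ⟨Vb, hb, hb'⟩ := ihb
    by_cases hy : y i = true
    · refine ⟨insert i Vb, ?_, fun z hz => ?_⟩
      · refine (card_insert_le _ _).trans ?_
        simp only [DTree.depth]; omega
      · have h1 := hz i (mem_insert_self _ _)
        rw [evalDT_node, evalDT_node, h1, if_pos hy, if_pos hy]
        exact hb' z fun j hj => hz j (mem_insert_of_mem hj)
    · refine ⟨insert i Va, ?_, fun z hz => ?_⟩
      · refine (card_insert_le _ _).trans ?_
        simp only [DTree.depth]; omega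
      · have h1 := hz i (mem_insert_self _ _)
        rw [evalDT_node, evalDT_node, h1, if_neg hy, if_neg hy]
        exact ha' z fun j hj => hz j (mem_insert_of_mem hj)

theorem Simple.hasCert {w : ℕ} {f : (ι → Bool) → Bool} {S : Finset ι} {x : ι → Bool}
    (h : Simple w f S x) : HasCert w f S x := by
  obtain ⟨T, hT, hf⟩ := h
  intro y hy hfy
  obtain ⟨V, hV, hc⟩ := dt_cert T y
  refine ⟨V, hV.trans hT, fun z hz hzy => ?_⟩
  rw [hf z hz, hc z hzy, ← hf y hy, hfy]

theorem simple_lit (i : ι) (b : Bool) (S : Finset ι) (x : ι → Bool) :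
    Simple 1 (AC0.lit i b).eval S x := by
  refine ⟨.node i (.leaf (!b)) (.leaf b), by simp [DTree.depth], fun y _ => ?_⟩
  simp only [AC0.eval, evalDT_node, evalDT_leaf]
  cases b <;> cases y i <;> rfl

theorem simple_const (b : Bool) (w : ℕ) (S : Finset ι) (x : ι → Bool) :
    Simple w (fun _ => b) S x :=
  ⟨.leaf b, by simp [DTree.depth], fun y _ => rfl⟩

theorem cert_or {w : ℕ} {S : Finset ι} {x : ι → Bool} {a : ℕ} {f : Fin a → AC0 ι}
    (h : ∀ j, Simple w (f j).eval S x) : HasCert w (AC0.or a f).eval S x := by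
  intro y hy hfy
  simp only [AC0.eval, decide_eq_true_eq] at hfy
  obtain ⟨j, hj⟩ := hfy
  obtain ⟨V, hV, hc⟩ := (h j).hasCert y hy hj
  refine ⟨V, hV, fun z hz hzy => ?_⟩
  simp only [AC0.eval, decide_eq_true_eq]
  exact ⟨j, hc z hz hzy⟩

theorem cert_and {w : ℕ} {S : Finset ι} {x : ι → Bool} {a : ℕ} {f : Fin a → AC0 ι}
    (h : ∀ j, Simple w (f j).eval S x) : HasCert w (fun y => !((AC0.and a f).eval y)) S x := by
  intro y hy hfy
  simp only [AC0.eval, Bool.not_eq_true', decide_eq_false_iff_not, not_forall] at hfy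
  obtain ⟨j, hj⟩ := hfy
  obtain ⟨V, hV, hc⟩ := (h j).neg.hasCert y hy (by simpa using hj)
  refine ⟨V, hV, fun z hz hzy => ?_⟩
  simp only [AC0.eval, Bool.not_eq_true', decide_eq_false_iff_not, not_forall]
  exact ⟨j, by simpa using hc z hz hzy⟩

def lev {M : ℕ} (gate : Fin M → AC0 ι) (t : ℕ) (i : Fin M) : (ι → Bool) → Bool :=
  if (gate i).depth ≤ t then (gate i).eval else fun _ => false

theorem lev_step {M : ℕ} (gate : Fin M → AC0 ι) (hcl : ChildClosed (fun D => ∃ i, gate i = D))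
    (t w : ℕ) (hw : 1 ≤ w) (S : Finset ι) (x : ι → Bool)
    (h : ∀ i, Simple w (lev gate t i) S x) (i : Fin M) :
    HasCert w (lev gate (t + 1) i) S x ∨ HasCert w (fun y => !(lev gate (t + 1) i y)) S x := by
  by_cases hd : (gate i).depth ≤ t + 1
  · simp only [lev, if_pos hd]
    cases hg : gate i with
    | lit v b => exact Or.inl ((simple_lit v b S x).mono (Subset.refl _) hw).hasCert
    | and a f =>
      right
      apply cert_and
      intro j
      obtain ⟨i', hi'⟩ := hcl.1 a f ⟨i, hg⟩ j
      have := h i'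
      have hdj : (gate i').depth ≤ t := by
        rw [hi']
        rw [hg] at hd
        simp only [AC0.depth] at hd
        have : (f j).depth ≤ Finset.univ.sup fun j => (f j).depth :=
          Finset.le_sup (f := fun j => (f j).depth) (mem_univ j)
        omega
      rw [lev, if_pos hdj, hi'] at this
      exact this
    | or a f =>
      left
      apply cert_or
      intro j
      obtain ⟨i', hi'⟩ := hcl.2 a f ⟨i, hg⟩ j
      have := h i'
      have hdj : (gate i').depth ≤ t := by
        rw [hi']
        rw [hg] at hd
        simp only [AC0.depth] at hd
        have : (f j).depth ≤ Finset.univ.sup fun j => (f j).depth :=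
          Finset.le_sup (f := fun j => (f j).depth) (mem_univ j)
        omega
      rw [lev, if_pos hdj, hi'] at this
      exact this
  · simp only [lev, if_neg hd]
    exact Or.inl (simple_const false w S x).hasCert

theorem lev_zero {M : ℕ} (gate : Fin M → AC0 ι) (w : ℕ) (hw : 1 ≤ w) (S : Finset ι)
    (x : ι → Bool) (i : Fin M) : Simple w (lev gate 0 i) S x := by
  by_cases hd : (gate i).depth ≤ 0
  · simp only [lev, if_pos hd]
    cases hg : gate i with
    | lit v b => exact (simple_lit v b S x).mono (Subset.refl _) hw
    | and a f => rw [hg] at hd; simp [AC0.depth] at hd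
    | or a f => rw [hg] at hd; simp [AC0.depth] at hd
  · simp only [lev, if_neg hd]
    exact simple_const false w S x

theorem iterate {M : ℕ} (gate : Fin M → AC0 ι) (hcl : ChildClosed (fun D => ∃ i, gate i = D))
    (w T : ℕ) (hw : 1 ≤ w) (p ζ θ : ℝ) (hp0 : 0 ≤ p) (hp1 : p ≤ 1) (hζ : 0 ≤ ζ) (hθ : 0 ≤ θ)
    (hθ1 : θ ≤ 1) (hp : 2 * p = ζ * θ) (h1 : (1 + 2 * ζ) ^ w ≤ 3 / 2) (t : ℕ) :
    ∃ A : Proc ι, A.P = p ^ t ∧ A.cnt (fun l x => ¬ ((∀ i, Simple w (lev gate t i) (A.S l x) x) ∧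
      (A.lost l x).card ≤ t * (T * (w + w)))) ≤
        t * (((M : ℝ) * θ ^ (w + 1)) ^ T * 2 ^ Fintype.card ι) := by
  induction t with
  | zero =>
    refine ⟨Proc.triv ι, by simp [Proc.triv], ?_⟩
    have : ∀ (l : (Proc.triv ι).Λ) (x : ι → Bool), ¬ ¬ ((∀ i, Simple w (lev gate 0 i)
      ((Proc.triv ι).S l x) x) ∧ ((Proc.triv ι).lost l x).card ≤ 0 * (T * (w + w))) := by
      intro l x
      rw [not_not]
      exact ⟨fun i => lev_zero gate w hw _ x i, by simp [Proc.lost, Proc.triv]⟩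
    classical
    have h0 : (Proc.triv ι).cnt (fun l x => ¬ ((∀ i, Simple w (lev gate 0 i)
      ((Proc.triv ι).S l x) x) ∧ ((Proc.triv ι).lost l x).card ≤ 0 * (T * (w + w)))) = 0 := by
      unfold Proc.cnt
      apply sum_eq_zero
      intro l _
      have h00 := (filter_eq_empty_iff (s := univ)).mpr (fun x _ => this l x)
      have h01 := congrArg (fun s => (Proc.triv ι).μ l * ((Finset.card s : ℕ) : ℝ)) h00
      simp only [card_empty, Nat.cast_zero, mul_zero] at h01
      convert h01
    rw [h0]
    simp
  | succ t ih =>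
    obtain ⟨A, hAP, hA⟩ := ih
    refine ⟨A.ext (lev gate (t + 1)) w w T p hp0 hp1, ?_, ?_⟩
    · simp only [Proc.ext, hAP, pow_succ]
    · have hb := A.ext_bound (lev gate (t + 1)) w w T p hp0 hp1 ζ θ hζ hθ hθ1 hp h1
        (t * (T * (w + w)))
      have hm : A.cnt (fun l x => ¬ ((∀ i, HasCert w (lev gate (t + 1) i) (A.S l x) x ∨
        HasCert w (fun y => !(lev gate (t + 1) i y)) (A.S l x) x) ∧
          (A.lost l x).card ≤ t * (T * (w + w)))) ≤ A.cnt (fun l x => ¬ ((∀ i, Simple w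
          (lev gate t i) (A.S l x) x) ∧ (A.lost l x).card ≤ t * (T * (w + w)))) := by
        apply A.cnt_mono
        intro l x hn hg
        exact hn ⟨fun i => lev_step gate hcl t w hw _ x hg.1 i, hg.2⟩
      rw [Fintype.card_fin] at hb
      rw [Nat.succ_mul]
      refine hb.trans ?_
      push_cast
      linarith

theorem iterate_final {M : ℕ} (gate : Fin M → AC0 ι)
    (hcl : ChildClosed (fun D => ∃ i, gate i = D))
    (w T k : ℕ) (hw : 1 ≤ w) (p ζ θ : ℝ) (hp0 : 0 ≤ p) (hp1 : p ≤ 1) (hζ : 0 ≤ ζ) (hθ : 0 ≤ θ)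
    (hθ1 : θ ≤ 1) (hp : 2 * p = ζ * θ) (h1 : (1 + 2 * ζ) ^ w ≤ 3 / 2)
    (p' θ' : ℝ) (hp0' : 0 ≤ p') (hp1' : p' ≤ 1) (hθ' : 0 ≤ θ')
    (hθ1' : θ' ≤ 1) (hp' : 2 * p' = ζ * θ') (d : ℕ) :
    ∃ A : Proc ι, A.P = p ^ d * p' ∧
      A.cnt (fun l x => ¬ ((∀ i, Simple k (lev gate d i) (A.S l x) x) ∧
      (A.lost l x).card ≤ d * (T * (w + w)) + T * (k + w))) ≤
        (d * ((M : ℝ) * θ ^ (w + 1)) ^ T + ((M : ℝ) * θ' ^ (k + 1)) ^ T) * 2 ^ Fintype.card ι := by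
  obtain ⟨A, hAP, hA⟩ := iterate gate hcl w T hw p ζ θ hp0 hp1 hζ hθ hθ1 hp h1 d
  refine ⟨A.ext (lev gate d) w k T p' hp0' hp1', ?_, ?_⟩
  · simp only [Proc.ext, hAP]
  · have hb := A.ext_bound (lev gate d) w k T p' hp0' hp1' ζ θ' hζ hθ' hθ1' hp' h1
      (d * (T * (w + w)))
    have hm : A.cnt (fun l x => ¬ ((∀ i, HasCert w (lev gate d i) (A.S l x) x ∨
        HasCert w (fun y => !(lev gate d i y)) (A.S l x) x) ∧
          (A.lost l x).card ≤ d * (T * (w + w)))) ≤ A.cnt (fun l x => ¬ ((∀ i, Simple w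
          (lev gate d i) (A.S l x) x) ∧ (A.lost l x).card ≤ d * (T * (w + w)))) := by
      apply A.cnt_mono
      intro l x hn hg
      exact hn ⟨fun i => Or.inl (hg.1 i).hasCert, hg.2⟩
    rw [Fintype.card_fin] at hb
    refine hb.trans ?_
    linarith

end SwL

namespace SwL

set_option linter.unusedSectionVars false

variable {ι : Type} [Fintype ι] [DecidableEq ι]

/-! ### decision trees to terms -/

def tterms (ρ : ι → Option Bool) : DTree ι Bool → List (List (ι × Bool))
  | .leaf b => if b then [[]] else []
  | .node i t0 t1 =>
    match ρ i with
    | some true => tterms ρ t1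
    | some false => tterms ρ t0
    | none => (tterms ρ t0).map (fun l => (i, false) :: l) ++
        (tterms ρ t1).map (fun l => (i, true) :: l)

theorem tterms_length (ρ : ι → Option Bool) (T : DTree ι Bool) :
    (tterms ρ T).length ≤ 2 ^ T.depth := by
  induction T with
  | leaf b => cases b <;> simp [tterms, DTree.depth]
  | node i a b iha ihb =>
    have h1 : 2 ^ a.depth ≤ 2 ^ (max a.depth b.depth) := Nat.pow_le_pow_right (by norm_num) (le_max_left _ _)
    have h2 : 2 ^ b.depth ≤ 2 ^ (max a.depth b.depth) := Nat.pow_le_pow_right (by norm_num) (le_max_right _ _)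
    have h3 : 2 ^ (1 + max a.depth b.depth) = 2 * 2 ^ (max a.depth b.depth) := by
      rw [pow_add, pow_one]
    simp only [tterms, DTree.depth]
    rw [h3]
    split
    · omega
    · omega
    · simp only [List.length_append, List.length_map]; omega

theorem tterms_width (ρ : ι → Option Bool) (T : DTree ι Bool) :
    ∀ l ∈ tterms ρ T, l.length ≤ T.depth := by
  induction T with
  | leaf b => cases b <;> simp [tterms, DTree.depth]
  | node i a b iha ihb =>
    intro l hl
    simp only [tterms, DTree.depth] at hl ⊢
    have h1 := le_max_left a.depth b.depth
    have h2 := le_max_right a.depth b.depth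
    split at hl
    · have := ihb l hl; omega
    · have := iha l hl; omega
    · simp only [List.mem_append, List.mem_map] at hl
      rcases hl with ⟨l', hl', rfl⟩ | ⟨l', hl', rfl⟩
      · have := iha l' hl'; simp only [List.length_cons]; omega
      · have := ihb l' hl'; simp only [List.length_cons]; omega

theorem tterms_count (ρ : ι → Option Bool) (T : DTree ι Bool) (x : ι → Bool) :
    (tterms ρ T).countP (fun t => t.all fun l => x l.1 == l.2) =
      if evalDT T (applyR ρ x) = true then 1 else 0 := by
  induction T with
  | leaf b => cases b <;> simp [tterms, evalDT_leaf]
  | node i a b iha ihb =>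
    simp only [tterms]
    split
    · rename_i h
      have h1 : applyR ρ x i = true := by simp [applyR, h]
      have h2 : evalDT (.node i a b) (applyR ρ x) = evalDT b (applyR ρ x) := by
        rw [evalDT_node, if_pos h1]
      rw [ihb, h2]
    · rename_i h
      have h1 : applyR ρ x i = false := by simp [applyR, h]
      have h2 : evalDT (.node i a b) (applyR ρ x) = evalDT a (applyR ρ x) := by
        rw [evalDT_node, h1]; rfl
      rw [iha, h2]
    · rename_i h
      have h1 : applyR ρ x i = x i := by simp [applyR, h]
      rw [List.countP_append, List.countP_map, List.countP_map]
      cases hx : x i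
      · have h2 : evalDT (.node i a b) (applyR ρ x) = evalDT a (applyR ρ x) := by
          rw [evalDT_node, h1, hx]; rfl
        rw [h2, ← iha]
        simp [Function.comp_def, hx]
      · have h2 : evalDT (.node i a b) (applyR ρ x) = evalDT b (applyR ρ x) := by
          rw [evalDT_node, h1, hx]; rfl
        rw [h2, ← ihb]
        simp [Function.comp_def, hx]

theorem list_sum_countP {β : Type} [AddCommMonoid β] {α : Type} (L : List α) (q : α → Bool) (c : β) :
    ∑ j : Fin L.length, (if q (L.get j) = true then c else 0) = (L.countP q) • c := by
  induction L with
  | nil => simp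
  | cons a L ih =>
    have : ∑ j : Fin (a :: L).length, (if q ((a :: L).get j) = true then c else 0) =
      (if q a = true then c else 0) + ∑ j : Fin L.length, (if q (L.get j) = true then c else 0) :=
      Fin.sum_univ_succ _
    rw [this, ih, List.countP_cons]
    split <;> simp [add_nsmul, add_comm]

/-- assembling the terms of all trees. -/
theorem assemble {a k : ℕ} (ρ : ι → Option Bool) (f : Fin a → (ι → Bool) → Bool)
    (hf : ∀ i, ∃ T : DTree ι Bool, T.depth ≤ k ∧ ∀ x, f i x = evalDT T (applyR ρ x)) :
    ∃ (N : ℕ) (idx : Fin N → Fin a) (T : Fin N → List (ι × Bool)), N ≤ a * 2 ^ k ∧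
      (∀ q, (T q).length ≤ k) ∧ ∀ (β : Type) [AddCommMonoid β] (w : Fin a → β) (x : ι → Bool),
        ∑ q, (if ((T q).all fun l => x l.1 == l.2) = true then w (idx q) else 0) =
        ∑ i, if f i x = true then w i else 0 := by
  choose D hD hE using hf
  let n : Fin a → ℕ := fun i => (tterms ρ (D i)).length
  let tt : (Σ i : Fin a, Fin (n i)) → List (ι × Bool) := fun q => (tterms ρ (D q.1)).get q.2
  refine ⟨∑ i, n i, fun q => (finSigmaFinEquiv.symm q).1,
    fun q => tt (finSigmaFinEquiv.symm q), ?_, ?_, ?_⟩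
  · calc ∑ i, n i ≤ ∑ i : Fin a, 2 ^ k := sum_le_sum fun i _ => (tterms_length ρ (D i)).trans
          (Nat.pow_le_pow_right (by norm_num) (hD i))
      _ = a * 2 ^ k := by simp
  · intro q
    exact (tterms_width ρ _ _ (List.get_mem _ _)).trans (hD _)
  · intro β _ w x
    refine (Equiv.sum_comp finSigmaFinEquiv.symm (fun q : (Σ i : Fin a, Fin (n i)) =>
      if ((tt q).all fun l => x l.1 == l.2) = true then w q.1 else 0)).trans ?_
    rw [Fintype.sum_sigma]
    apply sum_congr rfl
    intro i _
    refine (list_sum_countP (tterms ρ (D i)) (fun t => t.all fun l => x l.1 == l.2) (w i)).trans ?_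
    rw [tterms_count, hE i x]
    split <;> simp

theorem sym_and {a k : ℕ} (ρ : ι → Option Bool) (f : Fin a → (ι → Bool) → Bool)
    (hf : ∀ i, ∃ T : DTree ι Bool, T.depth ≤ k ∧ ∀ x, f i x = evalDT T (applyR ρ x))
    (g : (Fin a → Bool) → Bool) (hg : IsSymFun g) (s : ℝ) (hs : (a : ℝ) * 2 ^ k ≤ s) :
    IsSymAnd s (k : ℝ) (fun x => g fun i => f i x) := by
  obtain ⟨φ, hφ⟩ := hg
  obtain ⟨N, idx, T, hN, hT, h⟩ := assemble ρ f hf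
  refine ⟨N, fun y => φ (univ.filter fun i => y i = true).card, T, ⟨φ, fun y => rfl⟩, ?_, ?_, ?_⟩
  · refine le_trans ?_ hs
    exact_mod_cast hN
  · intro q; exact_mod_cast hT q
  · intro x
    have := h ℕ (fun _ => 1) x
    simp only
    rw [hφ, card_filter, card_filter, this]

theorem thr_and {a k : ℕ} (ρ : ι → Option Bool) (f : Fin a → (ι → Bool) → Bool)
    (hf : ∀ i, ∃ T : DTree ι Bool, T.depth ≤ k ∧ ∀ x, f i x = evalDT T (applyR ρ x))
    (g : (Fin a → Bool) → Bool) (hg : IsThrFun g) (s : ℝ) (hs : (a : ℝ) * 2 ^ k ≤ s) :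
    IsThrAnd s (k : ℝ) (fun x => g fun i => f i x) := by
  obtain ⟨w, θ, hφ⟩ := hg
  obtain ⟨N, idx, T, hN, hT, h⟩ := assemble ρ f hf
  refine ⟨N, fun y => decide (θ ≤ ∑ i, if y i = true then w (idx i) else 0), T,
    ⟨_, θ, fun y => rfl⟩, ?_, ?_, ?_⟩
  · refine le_trans ?_ hs
    exact_mod_cast hN
  · intro q; exact_mod_cast hT q
  · intro x
    have := h ℝ w x
    simp only
    rw [hφ, this]

/-! ### GIP -/

def b2z (b : Bool) : ZMod 2 := if b = true then 1 else 0

theorem b2z_inj {a b : Bool} (h : b2z a = b2z b) : a = b := by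
  revert h; cases a <;> cases b <;> decide

theorem b2z_xor (a b : Bool) : b2z (xor a b) = b2z a + b2z b := by
  cases a <;> cases b <;> decide

theorem b2z_bparity {α : Type} [Fintype α] (f : α → Bool) : b2z (bparity f) = ∑ a, b2z (f a) := by
  unfold b2z
  rw [sum_boole]
  unfold bparity
  simp only [decide_eq_true_eq]
  generalize (univ.filter fun a => f a = true).card = c
  rcases Nat.mod_two_eq_zero_or_one c with h | h
  · rw [h]; simp only [zero_ne_one, if_false]
    symm
    rw [ZMod.natCast_eq_zero_iff]
    exact Nat.dvd_of_mod_eq_zero h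
  · rw [h]; simp only [if_true]
    symm
    have : ((c : ℕ) : ZMod 2) = ((1 : ℕ) : ZMod 2) := by
      rw [ZMod.natCast_eq_natCast_iff]
      exact h
    simpa using this

theorem contains_gip (m k r m' : ℕ) (S : Finset (Fin m × Fin (k + 1) × Fin r))
    (x : Fin m × Fin (k + 1) × Fin r → Bool) (G : Finset (Fin m)) (hG : m' ≤ G.card)
    (hgood : ∀ i ∈ G, ∀ j, ∃ ℓ, (i, j, ℓ) ∈ S) :
    ContainsGIP m' (k + 1) (restrictF (RW m k r) (rho S x)) := by
  classical
  have hsel : ∃ sel : Fin m' → Fin m, Function.Injective sel ∧ ∀ i, sel i ∈ G := by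
    obtain ⟨G', hG', hc⟩ := exists_subset_card_eq hG
    let e := G'.equivFinOfCardEq hc
    exact ⟨fun i => (e.symm i).1, fun i j h => e.symm.injective (Subtype.ext h),
      fun i => hG' (e.symm i).2⟩
  obtain ⟨sel, hinj, hselG⟩ := hsel
  have h1 : ∀ q : Fin m' × Fin (k + 1), ∃ ℓ, (sel q.1, q.2, ℓ) ∈ S :=
    fun q => hgood _ (hselG q.1) q.2
  choose el hel using h1
  let e : Fin m' × Fin (k + 1) → Fin m × Fin (k + 1) × Fin r := fun q => (sel q.1, q.2, el q)
  let c : Fin m × Fin (k + 1) × Fin r → Bool := applyR (rho S x) (fun _ => false)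
  let κ : Fin m × Fin (k + 1) × Fin r → Option Bool :=
    fun v => if v ∈ Set.range e then none else some false
  have he : Function.Injective e := by
    rintro ⟨i, j⟩ ⟨i', j'⟩ h
    simp only [e, Prod.mk.injEq] at h
    rw [Prod.mk.injEq]
    exact ⟨hinj h.1, h.2.1⟩
  let row : (Fin m × Fin (k + 1) × Fin r → Bool) → Fin m → Bool := fun y i =>
    decide (∀ j : Fin (k + 1), bparity (fun ℓ : Fin r => y (i, j, ℓ)) = true)
  refine ⟨κ, e, bparity (fun i => if i ∈ Set.range sel then false else row c i),
    fun q => bparity (fun ℓ => if ℓ = el q then false else c (sel q.1, q.2, ℓ)), he, ?_, ?_⟩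
  · intro v
    simp only [κ]
    split <;> simp_all
  intro z
  set Y := applyR (rho S x) (applyR κ z) with hY
  have hY1 : ∀ q, Y (e q) = z (e q) := by
    intro q
    have h2 : κ (e q) = none := by simp [κ]
    have h3 : rho S x (e q) = none := by simp [rho, e, hel q]
    simp [hY, applyR, h2, h3]
  have hY2 : ∀ v, v ∉ Set.range e → Y v = c v := by
    intro v hv
    have h2 : κ v = some false := by simp only [κ, if_neg hv]
    simp [hY, applyR, h2, c]
  change bparity (row Y) = _
  apply b2z_inj
  rw [b2z_xor, b2z_bparity, b2z_bparity, b2z_bparity]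
  have hsplit : ∑ i, b2z (row Y i) = (∑ i, if i ∈ Set.range sel then 0 else b2z (row Y i)) +
      ∑ i, (if i ∈ Set.range sel then b2z (row Y i) else 0) := by
    rw [← sum_add_distrib]
    apply sum_congr rfl
    intro i _
    split <;> simp
  rw [hsplit]
  congr 1
  · apply sum_congr rfl
    intro i _
    split
    · rfl
    · rename_i hi
      congr 1
      simp only [row]
      congr 1
      apply propext
      apply forall_congr'
      intro j
      have : ∀ ℓ, Y (i, j, ℓ) = c (i, j, ℓ) := by
        intro ℓ
        apply hY2
        rintro ⟨q, hq⟩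
        apply hi
        refine ⟨q.1, ?_⟩
        simp only [e, Prod.mk.injEq] at hq
        exact hq.1
      simp only [this]
  · have : ∑ i, (if i ∈ Set.range sel then b2z (row Y i) else 0) = ∑ i, b2z (row Y (sel i)) := by
      rw [← sum_filter]
      have hf : (univ.filter fun i => i ∈ Set.range sel) = univ.image sel := by
        ext i; simp
      rw [hf, sum_image (fun a _ b _ h => hinj h)]
    rw [this]
    apply sum_congr rfl
    intro i _
    congr 1
    simp only [row]
    congr 1
    apply propext
    apply forall_congr'
    intro j
    have key : bparity (fun ℓ => Y (sel i, j, ℓ)) =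
        xor (bparity fun ℓ => if ℓ = el (i, j) then false else c (sel i, j, ℓ)) (z (e (i, j))) := by
      apply b2z_inj
      rw [b2z_xor, b2z_bparity, b2z_bparity, ← hY1]
      have h5 : b2z (Y (e (i, j))) = ∑ ℓ, if ℓ = el (i, j) then b2z (Y (e (i, j))) else 0 := by
        rw [sum_ite_eq' univ]; simp
      rw [h5, ← sum_add_distrib]
      apply sum_congr rfl
      intro ℓ _
      by_cases hl : ℓ = el (i, j)
      · rw [if_pos hl, if_pos hl, hl]
        simp [b2z, e]
      · rw [if_neg hl, if_neg hl, add_zero]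
        congr 1
        apply hY2
        rintro ⟨⟨i', j'⟩, hq⟩
        simp only [e, Prod.mk.injEq] at hq
        obtain ⟨ha, hb, hc⟩ := hq
        have := hinj ha
        subst this
        subst hb
        exact hl hc.symm
    rw [key]

end SwL

namespace SwL

set_option linter.unusedSectionVars false

/-! ### retention of structure -/

/-- blocks without stars. -/
def emptyBlocks {m k r : ℕ} (st : Fin m × Fin (k + 1) × Fin r → Bool) :
    Finset (Fin m × Fin (k + 1)) :=
  univ.filter fun q => ∀ ℓ, st (q.1, q.2, ℓ) = false

def blockVars {m k : ℕ} (r : ℕ) (B : Finset (Fin m × Fin (k + 1))) :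
    Finset (Fin m × Fin (k + 1) × Fin r) :=
  (B ×ˢ (univ : Finset (Fin r))).image fun q => (q.1.1, q.1.2, q.2)

theorem blockVars_card {m k : ℕ} (r : ℕ) (B : Finset (Fin m × Fin (k + 1))) :
    (blockVars r B).card = B.card * r := by
  unfold blockVars
  rw [card_image_of_injective, card_product, card_univ, Fintype.card_fin]
  rintro ⟨⟨a, b⟩, c⟩ ⟨⟨a', b'⟩, c'⟩ h
  simp only [Prod.mk.injEq] at h ⊢
  exact ⟨⟨h.1, h.2.1⟩, h.2.2⟩

theorem empty_bound {m k r : ℕ} (A : Proc (Fin m × Fin (k + 1) × Fin r)) (hP0 : 0 ≤ A.P)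
    (hP1 : A.P ≤ 1) (b : ℕ) :
    A.cnt (fun l _ => b ≤ (emptyBlocks (A.star l)).card) ≤
      (2 ^ (m * (k + 1)) * (1 - A.P) ^ (b * r)) *
        2 ^ Fintype.card (Fin m × Fin (k + 1) × Fin r) := by
  classical
  set n := Fintype.card (Fin m × Fin (k + 1) × Fin r) with hn
  have h1 : A.cnt (fun l _ => b ≤ (emptyBlocks (A.star l)).card) ≤
      (∑ l, A.μ l * (∑ B ∈ (univ : Finset (Fin m × Fin (k + 1))).powerset.filter
        (fun B => b ≤ B.card), if ∀ i ∈ blockVars r B, A.star l i = false then (1 : ℝ) else 0))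
        * 2 ^ n := by
    unfold Proc.cnt
    rw [sum_mul]
    apply sum_le_sum
    intro l _
    rw [mul_assoc]
    apply mul_le_mul_of_nonneg_left _ (A.μ0 l)
    by_cases hb : b ≤ (emptyBlocks (A.star l)).card
    · have h2 : (1 : ℝ) ≤ ∑ B ∈ (univ : Finset (Fin m × Fin (k + 1))).powerset.filter
        (fun B => b ≤ B.card), if ∀ i ∈ blockVars r B, A.star l i = false then (1 : ℝ) else 0 := by
        refine le_trans ?_ (single_le_sum (f := fun B => if ∀ i ∈ blockVars r B, A.star l i = false
          then (1 : ℝ) else 0) (fun B _ => by split <;> norm_num)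
          (a := emptyBlocks (A.star l)) (by simpa using hb))
        rw [if_pos]
        intro i hi
        simp only [blockVars, mem_image, mem_product] at hi
        obtain ⟨⟨q, c⟩, ⟨h3, _⟩, rfl⟩ := hi
        simp only [emptyBlocks, mem_filter, mem_univ, true_and] at h3
        exact h3 c
      have h4 : ((univ.filter fun _ : (Fin m × Fin (k + 1) × Fin r → Bool) =>
          b ≤ (emptyBlocks (A.star l)).card).card : ℝ) ≤ 2 ^ n := by
        have := card_filter_le (univ : Finset (Fin m × Fin (k + 1) × Fin r → Bool))
          (fun _ => b ≤ (emptyBlocks (A.star l)).card)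
        have h2 : (univ : Finset (Fin m × Fin (k + 1) × Fin r → Bool)).card = 2 ^ n := by
          rw [card_univ, Fintype.card_fun, Fintype.card_bool]
        rw [h2] at this
        exact_mod_cast this
      refine (le_of_eq (by congr!)).trans (h4.trans ?_)
      have : (0 : ℝ) ≤ 2 ^ n := by positivity
      nlinarith
    · simp only [hb]
      simp only [filter_false, card_empty, Nat.cast_zero]
      apply mul_nonneg _ (by positivity)
      exact sum_nonneg fun B _ => by split <;> norm_num
  refine h1.trans ?_
  apply mul_le_mul_of_nonneg_right _ (by positivity)
  simp only [mul_sum]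
  rw [sum_comm]
  calc _ = ∑ B ∈ (univ : Finset (Fin m × Fin (k + 1))).powerset.filter
        (fun B => b ≤ B.card), (1 - A.P) ^ (B.card * r) := by
        apply sum_congr rfl
        intro B _
        rw [A.empty_prob, blockVars_card]
    _ ≤ ∑ B ∈ (univ : Finset (Fin m × Fin (k + 1))).powerset.filter
        (fun B => b ≤ B.card), (1 - A.P) ^ (b * r) := by
        apply sum_le_sum
        intro B hB
        apply pow_le_pow_of_le_one (by linarith) (by linarith)
        exact Nat.mul_le_mul_right _ (mem_filter.mp hB).2
    _ ≤ ∑ B ∈ (univ : Finset (Fin m × Fin (k + 1))).powerset, (1 - A.P) ^ (b * r) := by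
        apply sum_le_sum_of_subset_of_nonneg (filter_subset _ _)
        intro B _ _
        exact pow_nonneg (by linarith) _
    _ = _ := by
        rw [sum_const, card_powerset, card_univ, Fintype.card_prod, Fintype.card_fin,
          Fintype.card_fin, nsmul_eq_mul]
        push_cast
        rfl

theorem good_rows {m k r : ℕ} (st : Fin m × Fin (k + 1) × Fin r → Bool)
    (S L : Finset (Fin m × Fin (k + 1) × Fin r)) (hL : ∀ v, st v = true → v ∉ S → v ∈ L)
    (b D m' : ℕ) (hb : (emptyBlocks st).card ≤ b) (hD : L.card ≤ D) (h : b + D + m' ≤ m) :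
    ∃ G : Finset (Fin m), m' ≤ G.card ∧ ∀ i ∈ G, ∀ j, ∃ ℓ, (i, j, ℓ) ∈ S := by
  classical
  refine ⟨univ \ ((emptyBlocks st).image Prod.fst ∪ L.image Prod.fst), ?_, ?_⟩
  · have h1 := le_card_sdiff ((emptyBlocks st).image Prod.fst ∪ L.image Prod.fst)
      (univ : Finset (Fin m))
    have h2 := card_union_le ((emptyBlocks st).image Prod.fst) (L.image Prod.fst)
    have h3 : ((emptyBlocks st).image Prod.fst).card ≤ _ := card_image_le
    have h4 : (L.image Prod.fst).card ≤ _ := card_image_le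
    rw [card_univ, Fintype.card_fin] at h1
    omega
  · intro i hi j
    simp only [mem_sdiff, mem_univ, true_and, mem_union, mem_image, not_or, not_exists,
      not_and] at hi
    by_contra hc
    push Not at hc
    by_cases he : ∀ ℓ, st (i, j, ℓ) = false
    · exact hi.1 (i, j) (by simpa [emptyBlocks] using he) rfl
    · push Not at he
      obtain ⟨ℓ, hl⟩ := he
      exact hi.2 (i, j, ℓ) (hL _ (by simpa using hl) (hc ℓ)) rfl

/-! ### the gate family -/

section gates

variable {ι : Type} [Fintype ι] [DecidableEq ι]

def gateList {u : ℕ} (a : Fin u → ℕ) (C : ∀ i, Fin (a i) → AC0 ι) : List (AC0 ι) :=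
  (List.ofFn fun i => (List.ofFn fun j => subs (C i j)).flatten).flatten

theorem mem_gateList {u : ℕ} (a : Fin u → ℕ) (C : ∀ i, Fin (a i) → AC0 ι) (D : AC0 ι) :
    D ∈ gateList a C ↔ ∃ i j, D ∈ subs (C i j) := by
  simp [gateList, List.mem_flatten, List.mem_ofFn]

theorem gateList_length {u : ℕ} (a : Fin u → ℕ) (C : ∀ i, Fin (a i) → AC0 ι) :
    (gateList a C).length = ∑ i, ∑ j, (C i j).size := by
  simp only [gateList, List.length_flatten, List.map_ofFn, List.sum_ofFn, Function.comp_def,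
    subs_length]

theorem gateList_closed {u : ℕ} (a : Fin u → ℕ) (C : ∀ i, Fin (a i) → AC0 ι) :
    ChildClosed (fun D => ∃ i, (gateList a C).get i = D) := by
  have e : ∀ D, (∃ i, (gateList a C).get i = D) ↔ ∃ i j, D ∈ subs (C i j) := by
    intro D
    rw [← mem_gateList, List.mem_iff_get]
  constructor
  · intro n f h j
    rw [e] at h ⊢
    obtain ⟨i, i', h⟩ := h
    exact ⟨i, i', (subs_closed _).1 n f h j⟩
  · intro n f h j
    rw [e] at h ⊢
    obtain ⟨i, i', h⟩ := h
    exact ⟨i, i', (subs_closed _).2 n f h j⟩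

end gates

theorem main_param (m k r d u : ℕ) (s : ℝ)
    (h : (Fin u → Bool) → Bool) (Fi : Fin u → (Fin m × Fin (k + 1) × Fin r → Bool) → Bool)
    (hFi : ∀ i, SymOnAC0 s d (Fi i) ∨ ThrOnAC0 s d (Fi i))
    (w T : ℕ) (hw : 1 ≤ w) (p ζ θ : ℝ) (hp0 : 0 ≤ p) (hp1 : p ≤ 1) (hζ : 0 ≤ ζ) (hθ : 0 ≤ θ)
    (hθ1 : θ ≤ 1) (hp : 2 * p = ζ * θ) (h1 : (1 + 2 * ζ) ^ w ≤ 3 / 2)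
    (p' θ' : ℝ) (hp0' : 0 ≤ p') (hp1' : p' ≤ 1) (hθ' : 0 ≤ θ')
    (hθ1' : θ' ≤ 1) (hp' : 2 * p' = ζ * θ') (b : ℕ)
    (hb : b + (d * (T * (w + w)) + T * (k + w)) + m / 2 ≤ m)
    (hsk : (2 : ℝ) ^ k ≤ s) (ε : ℝ)
    (hε1 : ((u : ℝ) * s * θ ^ (w + 1)) ^ T ≤ ε) (hε2 : ((u : ℝ) * s * θ' ^ (k + 1)) ^ T ≤ ε)
    (hε3 : 2 ^ (m * (k + 1)) * (1 - p ^ d * p') ^ (b * r) ≤ ε) :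
    ∃ R : ((Fin m × Fin (k + 1) × Fin r) → Option Bool) → ℝ,
      IsFair R ∧
      1 - (d + 2) * ε ≤
        prOf R fun ρ =>
          (∃ F' : Fin u → (Fin m × Fin (k + 1) × Fin r → Bool) → Bool,
            (∀ i, IsSymAnd (s ^ 2) (k : ℝ) (F' i) ∨
              IsThrAnd (s ^ 2) (k : ℝ) (F' i)) ∧
            ∀ x, restrictF (fun y => h fun i => Fi i y) ρ x =
              h fun i => F' i x) ∧
          ContainsGIP (m / 2) (k + 1) (restrictF (RW m k r) ρ) := by
  classical
  have hF2 : ∀ i, ∃ (a : ℕ) (g : (Fin a → Bool) → Bool) (C : Fin a → AC0 (Fin m × Fin (k + 1) × Fin r)),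
      (IsSymFun g ∨ IsThrFun g) ∧ (∀ j, (C j).depth ≤ d) ∧ (((1 + ∑ j, (C j).size : ℕ) : ℝ) ≤ s) ∧
      ∀ x, Fi i x = g fun j => (C j).eval x := by
    intro i
    rcases hFi i with ⟨a, g, C, h1, h2⟩ | ⟨a, g, C, h1, h2⟩
    · exact ⟨a, g, C, Or.inl h1, h2⟩
    · exact ⟨a, g, C, Or.inr h1, h2⟩
  choose a g C hg hdep hsize heval using hF2
  have hs1 : (1 : ℝ) ≤ s := le_trans (one_le_pow₀ (by norm_num)) hsk
  obtain ⟨M, hM⟩ : ∃ M, M = (gateList a C).length := ⟨_, rfl⟩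
  have hMb : ((gateList a C).length : ℝ) ≤ u * s := by
    rw [gateList_length]
    push_cast
    calc (∑ i, ∑ j, ((C i j).size : ℝ)) ≤ ∑ i : Fin u, s := by
          apply sum_le_sum
          intro i _
          have := hsize i
          push_cast at this
          linarith
      _ = u * s := by simp
  obtain ⟨A, hAP, hA⟩ := iterate_final (gateList a C).get (gateList_closed a C) w T k hw p ζ θ
    hp0 hp1 hζ hθ hθ1 hp h1 p' θ' hp0' hp1' hθ' hθ1' hp' d
  have hP0 : 0 ≤ A.P := by rw [hAP]; positivity
  have hP1 : A.P ≤ 1 := by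
    rw [hAP]
    exact mul_le_one₀ (pow_le_one₀ hp0 hp1) hp0' hp1'
  refine ⟨A.R, A.fair, ?_⟩
  rw [A.prOf_R]
  set n := Fintype.card (Fin m × Fin (k + 1) × Fin r) with hn
  have h2n : (0 : ℝ) < 2 ^ n := by positivity
  rw [le_div_iff₀ h2n]
  have hE := empty_bound A hP0 hP1 b
  rw [hAP] at hE
  have hbad := A.cnt_or (fun l x => ¬ ((∀ i, Simple k (lev (gateList a C).get d i) (A.S l x) x) ∧
      (A.lost l x).card ≤ d * (T * (w + w)) + T * (k + w)))
    (fun l _ => b ≤ (emptyBlocks (A.star l)).card)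
  have hm1 : ((((gateList a C).length : ℕ) : ℝ) * θ ^ (w + 1)) ^ T ≤ ε := by
    refine le_trans ?_ hε1
    gcongr
  have hm2 : ((((gateList a C).length : ℕ) : ℝ) * θ' ^ (k + 1)) ^ T ≤ ε := by
    refine le_trans ?_ hε2
    gcongr
  have hbad2 : A.cnt (fun l x => ¬ ((∀ i, Simple k (lev (gateList a C).get d i) (A.S l x) x) ∧
      (A.lost l x).card ≤ d * (T * (w + w)) + T * (k + w)) ∨
      b ≤ (emptyBlocks (A.star l)).card) ≤ (d + 2) * ε * 2 ^ n := by
    refine hbad.trans ?_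
    calc _ ≤ (d * ε + ε) * 2 ^ n + ε * 2 ^ n := by
          apply add_le_add
          · refine hA.trans ?_
            gcongr
          · refine hE.trans ?_
            gcongr
      _ = _ := by ring
  have hc := A.cnt_compl (fun l x => ¬ ((∀ i, Simple k (lev (gateList a C).get d i) (A.S l x) x) ∧
      (A.lost l x).card ≤ d * (T * (w + w)) + T * (k + w)) ∨
      b ≤ (emptyBlocks (A.star l)).card)
  have hfin : (1 - (d + 2) * ε) * 2 ^ n ≤ A.cnt (fun l x => ¬ (¬ ((∀ i, Simple k
      (lev (gateList a C).get d i) (A.S l x) x) ∧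
      (A.lost l x).card ≤ d * (T * (w + w)) + T * (k + w)) ∨
      b ≤ (emptyBlocks (A.star l)).card)) := by
    linarith
  refine hfin.trans (A.cnt_mono ?_)
  intro l x hlx
  rw [not_or, not_not, not_le] at hlx
  obtain ⟨⟨hS, hlost⟩, hemp⟩ := hlx
  constructor
  · refine ⟨fun i y => g i fun j => (C i j).eval (applyR (rho (A.S l x) x) y), ?_, ?_⟩
    · intro i
      have hf : ∀ j, ∃ D : DTree (Fin m × Fin (k + 1) × Fin r) Bool, D.depth ≤ k ∧
          ∀ y, (C i j).eval (applyR (rho (A.S l x) x) y) =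
            evalDT D (applyR (rho (A.S l x) x) y) := by
        intro j
        have hmem : C i j ∈ gateList a C := (mem_gateList a C _).2 ⟨i, j, self_mem_subs _⟩
        obtain ⟨q, hq⟩ := List.mem_iff_get.mp hmem
        obtain ⟨D, hD, hDe⟩ := hS q
        refine ⟨D, hD, fun y => ?_⟩
        have hd' : ((gateList a C).get q).depth ≤ d := by rw [hq]; exact hdep i j
        have := hDe (applyR (rho (A.S l x) x) y) (by
          intro v hv
          simp [applyR, rho, hv])
        rw [lev, if_pos hd', hq] at this
        exact this
      have hai : (a i : ℝ) * 2 ^ k ≤ s ^ 2 := by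
        have h3 : (a i : ℝ) ≤ s := by
          refine le_trans ?_ (hsize i)
          have : a i ≤ 1 + ∑ j, (C i j).size := by
            have h4 : ∑ j : Fin (a i), 1 ≤ ∑ j, (C i j).size := by
              apply sum_le_sum
              intro j _
              rw [← subs_length]
              exact List.length_pos_of_mem (self_mem_subs _)
            simp at h4
            omega
          exact_mod_cast this
        rw [sq]
        gcongr
      rcases hg i with hg | hg
      · exact Or.inl (sym_and (rho (A.S l x) x)
          (fun j y => (C i j).eval (applyR (rho (A.S l x) x) y)) hf (g i) hg _ hai)
      · exact Or.inr (thr_and (rho (A.S l x) x)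
          (fun j y => (C i j).eval (applyR (rho (A.S l x) x) y)) hf (g i) hg _ hai)
    · intro y
      simp only [restrictF]
      congr 1
      funext i
      exact heval i _
  · obtain ⟨G, hG, hgood⟩ := good_rows (A.star l) (A.S l x) (A.lost l x) (by
      intro v hv hv'
      simp [Proc.lost, hv, hv']) b _ (m / 2) hemp.le hlost hb
    exact contains_gip m k r (m / 2) _ x G hG hgood

end SwL

namespace SwL

set_option linter.unusedSectionVars false

/-! ### asymptotics -/

theorem polylog (C : ℝ) (j : ℕ) (a : ℝ) (ha : 0 < a) :
    ∀ᶠ x : ℝ in Filter.atTop, C * (Real.logb 2 x) ^ j ≤ x ^ a := by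
  have h := isLittleO_log_rpow_rpow_atTop (j : ℝ) ha
  have hl2 : 0 < Real.log 2 := Real.log_pos (by norm_num)
  have h2 := h.def (c := (Real.log 2) ^ j / (|C| + 1)) (by positivity)
  filter_upwards [h2, Filter.eventually_ge_atTop 1] with x hx hx1
  have hlog : 0 ≤ Real.log x := Real.log_nonneg hx1
  rw [Real.rpow_natCast, Real.norm_of_nonneg (by positivity), Real.norm_of_nonneg (by positivity)] at hx
  rw [Real.logb, div_pow]
  have hC : C ≤ |C| + 1 := by linarith [le_abs_self C]
  calc C * (Real.log x ^ j / Real.log 2 ^ j)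
      ≤ (|C| + 1) * (Real.log x ^ j / Real.log 2 ^ j) := by gcongr
    _ ≤ (|C| + 1) * ((Real.log 2 ^ j / (|C| + 1) * x ^ a) / Real.log 2 ^ j) := by gcongr
    _ = x ^ a := by field_simp

theorem asym (d : ℕ) : ∃ N : ℕ, ∀ m : ℕ, N ≤ m →
    (100000 : ℝ) ≤ Real.logb 2 m ∧ Real.logb 2 m ≤ (m : ℝ) ^ (0.01 : ℝ) ∧
    32 * (d + 1) * Real.logb 2 m ^ 2 ≤ (m : ℝ) ^ (0.015 : ℝ) ∧
    (256 ^ d * 16) * Real.logb 2 m ^ (2 * d + 1) ≤ (m : ℝ) ^ (0.5 : ℝ) ∧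
    32 * Real.logb 2 m ^ 2 ≤ (m : ℝ) ^ (0.25 : ℝ) ∧
    2 * ((d : ℝ) + 2) ≤ (m : ℝ) ^ (0.5 : ℝ) := by
  have e1 : ∀ᶠ x : ℝ in Filter.atTop, (100000 : ℝ) ≤ Real.logb 2 x :=
    (Real.tendsto_logb_atTop (by norm_num)).eventually_ge_atTop _
  have e2 := polylog 1 1 0.01 (by norm_num)
  have e3 := polylog (32 * (d + 1)) 2 0.015 (by norm_num)
  have e4 := polylog (256 ^ d * 16) (2 * d + 1) 0.5 (by norm_num)
  have e5 := polylog 32 2 0.25 (by norm_num)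
  have e6 := polylog (2 * ((d : ℝ) + 2)) 0 0.5 (by norm_num)
  have e := e1.and (e2.and (e3.and (e4.and (e5.and e6))))
  have e' := tendsto_natCast_atTop_atTop.eventually e
  obtain ⟨N, hN⟩ := Filter.eventually_atTop.mp e'
  refine ⟨N, fun m hm => ?_⟩
  obtain ⟨h1, h2, h3, h4, h5, h6⟩ := hN m hm
  simp only [one_mul, pow_one] at h2
  simp only [pow_zero, mul_one] at h6
  exact ⟨h1, h2, h3, h4, h5, h6⟩

theorem exp_quarter : Real.exp (1 / 4) ≤ 3 / 2 := by
  have h : Real.exp (1 / 4) ^ 4 ≤ (3 / 2) ^ 4 := by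
    rw [← Real.exp_nat_mul]
    have := Real.exp_one_lt_d9
    norm_num
    linarith
  exact (pow_le_pow_iff_left₀ (Real.exp_pos _).le (by norm_num) (by norm_num)).mp h

theorem n_le_cube (m k : ℕ) (hk : k = ⌊(0.0005 : ℝ) * Real.logb 2 (m : ℝ)⌋₊) :
    m * (k + 1) * m ≤ m ^ 3 := by
  rcases Nat.eq_zero_or_pos m with rfl | hm
  · simp
  have hk' : k + 1 ≤ m := by
    have hm1 : (1 : ℝ) ≤ m := by exact_mod_cast hm
    have h0 : 0 ≤ Real.logb 2 (m : ℝ) := Real.logb_nonneg (by norm_num) hm1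
    have h1 : (k : ℝ) ≤ 0.0005 * Real.logb 2 (m : ℝ) := by
      rw [hk]; exact Nat.floor_le (by positivity)
    have h2 : Real.logb 2 (m : ℝ) ≤ 2 * m := by
      rw [Real.logb, div_le_iff₀ (Real.log_pos (by norm_num))]
      have := Real.log_le_sub_one_of_pos (by linarith : (0 : ℝ) < m)
      have := Real.log_two_gt_d9
      nlinarith
    have : (k : ℝ) < m := by linarith
    have : k < m := by exact_mod_cast this
    omega
  calc m * (k + 1) * m ≤ m * m * m := by gcongr
    _ = m ^ 3 := by ring

theorem exp_two_le {y : ℝ} (hy : y ≤ -2) : (2 : ℝ) ^ y ≤ Real.exp (-1) := by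
  rw [Real.rpow_def_of_pos (by norm_num)]
  apply Real.exp_le_exp.mpr
  have := Real.log_two_gt_d9
  nlinarith

set_option maxHeartbeats 2000000 in
theorem main_numeric (d m k n : ℕ) (hk : k = ⌊(0.0005 : ℝ) * Real.logb 2 (m : ℝ)⌋₊)
    (hn : n = m * (k + 1) * m) (u : ℕ) (hu : u = ⌊(n : ℝ) ^ (0.249 : ℝ)⌋₊)
    (s : ℝ) (hs : s = (n : ℝ) ^ ((0.000001 : ℝ) * Real.logb 2 (n : ℝ)))
    (L : ℝ) (hL : L = Real.logb 2 m)
    (e1 : (100000 : ℝ) ≤ L) (e2 : L ≤ (m : ℝ) ^ (0.01 : ℝ))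
    (e3 : 32 * (d + 1) * L ^ 2 ≤ (m : ℝ) ^ (0.015 : ℝ))
    (e4 : (256 ^ d * 16) * L ^ (2 * d + 1) ≤ (m : ℝ) ^ (0.5 : ℝ))
    (e5 : 32 * L ^ 2 ≤ (m : ℝ) ^ (0.25 : ℝ))
    (e6 : 2 * ((d : ℝ) + 2) ≤ (m : ℝ) ^ (0.5 : ℝ))
    (h : (Fin u → Bool) → Bool) (Fi : Fin u → (Fin m × Fin (k + 1) × Fin m → Bool) → Bool)
    (hFi : ∀ i, SymOnAC0 s d (Fi i) ∨ ThrOnAC0 s d (Fi i)) :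
    ∃ R : ((Fin m × Fin (k + 1) × Fin m) → Option Bool) → ℝ,
      IsFair R ∧
      1 - Real.exp (-(1 / 2 * (n : ℝ) ^ (0.49 : ℝ))) ≤
        prOf R fun ρ =>
          (∃ F' : Fin u → (Fin m × Fin (k + 1) × Fin m → Bool) → Bool,
            (∀ i, IsSymAnd (s ^ 2) (k : ℝ) (F' i) ∨
              IsThrAnd (s ^ 2) (k : ℝ) (F' i)) ∧
            ∀ x, restrictF (fun y => h fun i => Fi i y) ρ x =
              h fun i => F' i x) ∧
          ContainsGIP (m / 2) (k + 1) (restrictF (RW m k m) ρ) := by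
  have hmpos : 0 < m := by
    rcases Nat.eq_zero_or_pos m with rfl | hm
    · simp at hL; linarith
    · exact hm
  have hX0 : (0 : ℝ) < m := by exact_mod_cast hmpos
  have hX1 : (1 : ℝ) ≤ m := by exact_mod_cast hmpos
  have hX2 : (m : ℝ) = 2 ^ L := by
    rw [hL, Real.rpow_logb (by norm_num) (by norm_num) hX0]
  have hk1 : (k : ℝ) ≤ 0.0005 * L := by
    rw [hk, hL]; apply Nat.floor_le; rw [← hL]; positivity
  have hk2 : 0.0005 * L ≤ (k : ℝ) + 1 := by
    rw [hk, hL]; exact (Nat.lt_floor_add_one _).le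
  have hkL : (k : ℝ) + 1 ≤ L := by linarith
  have hnR : (n : ℝ) = m * (k + 1) * m := by rw [hn]; push_cast; ring
  have hn1 : (n : ℝ) ≤ (m : ℝ) ^ (2.01 : ℝ) := by
    have : (m : ℝ) ^ (2.01 : ℝ) = m * (m : ℝ) ^ (0.01 : ℝ) * m := by
      rw [show (2.01 : ℝ) = 1 + 0.01 + 1 by norm_num, Real.rpow_add hX0, Real.rpow_add hX0,
        Real.rpow_one]
    rw [this, hnR]
    gcongr
    linarith
  have hn2 : (m : ℝ) ^ (2 : ℝ) ≤ n := by
    have : (m : ℝ) ^ (2 : ℝ) = m * 1 * m := by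
      rw [show (2 : ℝ) = ((2 : ℕ) : ℝ) by norm_num, Real.rpow_natCast]; ring
    rw [this, hnR]
    gcongr
    linarith [(Nat.cast_nonneg k : (0 : ℝ) ≤ k)]
  have hn0 : (0 : ℝ) < n := lt_of_lt_of_le (by positivity) hn2
  have hn49a : (n : ℝ) ^ (0.49 : ℝ) ≤ (m : ℝ) ^ (0.985 : ℝ) := by
    calc (n : ℝ) ^ (0.49 : ℝ) ≤ ((m : ℝ) ^ (2.01 : ℝ)) ^ (0.49 : ℝ) := by gcongr
      _ = (m : ℝ) ^ (0.9849 : ℝ) := by rw [← Real.rpow_mul hX0.le]; norm_num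
      _ ≤ _ := by apply Real.rpow_le_rpow_of_exponent_le hX1; norm_num
  have hn49b : (m : ℝ) ^ (0.5 : ℝ) ≤ (n : ℝ) ^ (0.49 : ℝ) := by
    calc (m : ℝ) ^ (0.5 : ℝ) ≤ (m : ℝ) ^ (0.98 : ℝ) := by
          apply Real.rpow_le_rpow_of_exponent_le hX1; norm_num
      _ = ((m : ℝ) ^ (2 : ℝ)) ^ (0.49 : ℝ) := by rw [← Real.rpow_mul hX0.le]; norm_num
      _ ≤ _ := by gcongr
  have hn49c : (1 : ℝ) ≤ (n : ℝ) ^ (0.49 : ℝ) := by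
    refine le_trans ?_ hn49b
    exact Real.one_le_rpow hX1 (by norm_num)
  -- logarithm of n
  set l := Real.logb 2 (n : ℝ) with hl
  have hnl : (n : ℝ) = 2 ^ l := by
    rw [hl, Real.rpow_logb (by norm_num) (by norm_num) hn0]
  have hl1 : l ≤ 3 * L := by
    rw [hnl, hX2, ← Real.rpow_mul (by norm_num), Real.rpow_le_rpow_left_iff (by norm_num)] at hn1
    linarith
  have hl2 : L ≤ l := by
    rw [hnl, hX2, ← Real.rpow_mul (by norm_num), Real.rpow_le_rpow_left_iff (by norm_num)] at hn2
    linarith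
  have hl0 : 0 ≤ l := by linarith
  have hs2 : s = 2 ^ (0.000001 * l ^ 2) := by
    rw [hs, hnl, ← Real.rpow_mul (by norm_num)]
    congr 1; ring
  have hL0 : 0 ≤ L := by linarith
  have hLL : 100000 * L ≤ L ^ 2 := by
    rw [sq]; exact mul_le_mul_of_nonneg_right e1 hL0
  have hl9 : l ^ 2 ≤ 9 * L ^ 2 := by
    have := pow_le_pow_left₀ hl0 hl1 2
    rw [mul_pow] at this
    linarith
  have hl10 : L ^ 2 ≤ l ^ 2 := pow_le_pow_left₀ hL0 hl2 2
  have hs3 : s ≤ 2 ^ (0.000009 * L ^ 2) := by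
    rw [hs2]
    apply Real.rpow_le_rpow_of_exponent_le (by norm_num)
    linarith
  have hsk : (2 : ℝ) ^ k ≤ s := by
    rw [hs2, ← Real.rpow_natCast]
    apply Real.rpow_le_rpow_of_exponent_le (by norm_num)
    linarith
  have hu1 : (u : ℝ) ≤ 2 ^ L := by
    calc (u : ℝ) ≤ (n : ℝ) ^ (0.249 : ℝ) := by rw [hu]; exact Nat.floor_le (by positivity)
      _ = 2 ^ (l * 0.249) := by rw [hnl, ← Real.rpow_mul (by norm_num)]
      _ ≤ _ := by
        apply Real.rpow_le_rpow_of_exponent_le (by norm_num)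
        linarith
  have hs0 : 0 ≤ s := by rw [hs2]; positivity
  have hus : (u : ℝ) * s ≤ 2 ^ (L + 0.000009 * L ^ 2) := by
    rw [Real.rpow_add (by norm_num)]
    gcongr
  -- parameters
  obtain ⟨w, hw⟩ : ∃ w : ℕ, w = ⌈L ^ 2⌉₊ := ⟨_, rfl⟩
  have hw1 : L ^ 2 ≤ w := by rw [hw]; exact Nat.le_ceil _
  have hw2 : (w : ℝ) ≤ 2 * L ^ 2 := by
    have : (w : ℝ) < L ^ 2 + 1 := by rw [hw]; exact Nat.ceil_lt_add_one (by positivity)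
    linarith
  have hw0 : (0 : ℝ) < w := lt_of_lt_of_le (by positivity) hw1
  have hw3 : 1 ≤ w := by exact_mod_cast hw0
  have hw4 : (1 : ℝ) ≤ w := by exact_mod_cast hw3
  obtain ⟨T, hT⟩ : ∃ T : ℕ, T = ⌈(n : ℝ) ^ (0.49 : ℝ)⌉₊ := ⟨_, rfl⟩
  have hT1 : (n : ℝ) ^ (0.49 : ℝ) ≤ T := by rw [hT]; exact Nat.le_ceil _
  have hT2 : (T : ℝ) ≤ 2 * (m : ℝ) ^ (0.985 : ℝ) := by
    have : (T : ℝ) < (n : ℝ) ^ (0.49 : ℝ) + 1 := by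
      rw [hT]; exact Nat.ceil_lt_add_one (by positivity)
    linarith
  have hsqrt : (m : ℝ) ^ (0.5 : ℝ) * (m : ℝ) ^ (0.5 : ℝ) = m := by
    rw [← Real.rpow_add hX0]; norm_num
  set q := (m : ℝ) ^ (0.5 : ℝ) with hq
  have hq1 : 1 ≤ q := Real.one_le_rpow hX1 (by norm_num)
  have hq0 : 0 < q := by linarith
  have hqq : (m : ℝ) ^ (0.25 : ℝ) * (m : ℝ) ^ (0.25 : ℝ) = q := by
    rw [← Real.rpow_add hX0, hq, show (0.25 + 0.25 : ℝ) = 0.5 by norm_num]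
  set v := (m : ℝ) ^ (0.25 : ℝ) with hv
  have hv1 : 1 ≤ v := Real.one_le_rpow hX1 (by norm_num)
  have hv0 : 0 < v := by linarith
  have hθ' : 16 * (w : ℝ) * (1 / q) ≤ 1 / v := by
    rw [mul_one_div, div_le_div_iff₀ hq0 hv0, ← hqq, one_mul]
    apply mul_le_mul_of_nonneg_right _ hv0.le
    linarith
  have hvL : 1 / v = (2 : ℝ) ^ (-(L / 4)) := by
    rw [hv, hX2, ← Real.rpow_mul (by norm_num), one_div, ← Real.rpow_neg (by norm_num)]
    congr 1; ring
  have hexp : ∀ z : ℝ, 0 ≤ z → z ≤ Real.exp (-1) → z ^ T ≤ Real.exp (-((n : ℝ) ^ (0.49 : ℝ))) := by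
    intro z hz hz1
    calc z ^ T ≤ (Real.exp (-1)) ^ T := by gcongr
      _ = Real.exp (-T) := by rw [← Real.exp_nat_mul]; congr 1; ring
      _ ≤ _ := by apply Real.exp_le_exp.mpr; linarith
  obtain ⟨R, hR, hpr⟩ := main_param m k m d u s h Fi hFi w T hw3 (1 / (128 * w)) (1 / (8 * w)) (1 / 8)
    (by positivity)
    (by rw [div_le_one (by positivity)]; linarith)
    (by positivity) (by norm_num) (by norm_num) (by field_simp; norm_num)
    (by
      have h2 : 1 + 2 * (1 / (8 * (w : ℝ))) ≤ Real.exp (1 / (4 * w)) := by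
        have := Real.add_one_le_exp (1 / (4 * (w : ℝ)))
        refine le_trans (le_of_eq ?_) this
        field_simp; ring
      calc (1 + 2 * (1 / (8 * (w : ℝ)))) ^ w ≤ (Real.exp (1 / (4 * w))) ^ w := by gcongr
        _ = Real.exp (1 / 4) := by
          rw [← Real.exp_nat_mul]; congr 1; field_simp
        _ ≤ _ := exp_quarter)
    (1 / q) (16 * w * (1 / q)) (by positivity)
    (by rw [div_le_one hq0]; exact hq1) (by positivity)
    (hθ'.trans (by rw [div_le_one hv0]; exact hv1)) (by field_simp; norm_num) (m / 4)
    (by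
      have hkw : (k : ℝ) ≤ w := by linarith
      have hkw' : k ≤ w := by exact_mod_cast hkw
      have h2 : d * (T * (w + w)) + T * (k + w) ≤ T * ((2 * d + 2) * w) := by
        calc d * (T * (w + w)) + T * (k + w) ≤ d * (T * (w + w)) + T * (w + w) := by gcongr
          _ = _ := by ring
      have h3 : 4 * (T * ((2 * d + 2) * w)) ≤ m := by
        have : 4 * ((T : ℝ) * ((2 * d + 2) * w)) ≤ m := by
          calc 4 * ((T : ℝ) * ((2 * d + 2) * w))
              ≤ 4 * ((2 * (m : ℝ) ^ (0.985 : ℝ)) * ((2 * d + 2) * (2 * L ^ 2))) := by gcongr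
            _ = (m : ℝ) ^ (0.985 : ℝ) * (32 * (d + 1) * L ^ 2) := by ring
            _ ≤ (m : ℝ) ^ (0.985 : ℝ) * (m : ℝ) ^ (0.015 : ℝ) := by gcongr
            _ = m := by rw [← Real.rpow_add hX0]; norm_num
        exact_mod_cast this
      omega)
    hsk (Real.exp (-((n : ℝ) ^ (0.49 : ℝ))))
    (by
      apply hexp _ (by positivity)
      have h2 : ((1 : ℝ) / 8) ^ (w + 1) ≤ 2 ^ (-(3 * L ^ 2)) := by
        have h3 : ((1 : ℝ) / 8) = 2 ^ (-3 : ℝ) := by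
          rw [Real.rpow_neg (by norm_num), show (3 : ℝ) = ((3 : ℕ) : ℝ) by norm_num,
            Real.rpow_natCast]; norm_num
        rw [h3, ← Real.rpow_natCast, ← Real.rpow_mul (by norm_num)]
        apply Real.rpow_le_rpow_of_exponent_le (by norm_num)
        push_cast
        linarith
      calc (u : ℝ) * s * (1 / 8) ^ (w + 1) ≤ 2 ^ (L + 0.000009 * L ^ 2) * 2 ^ (-(3 * L ^ 2)) := by
            gcongr
        _ = (2 : ℝ) ^ (L + 0.000009 * L ^ 2 + (-(3 * L ^ 2))) := by
            rw [← Real.rpow_add (by norm_num)]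
        _ ≤ _ := by
            apply exp_two_le
            linarith)
    (by
      apply hexp _ (by positivity)
      have h2 : (16 * (w : ℝ) * (1 / q)) ^ (k + 1) ≤ 2 ^ (-(0.000125 * L ^ 2)) := by
        calc (16 * (w : ℝ) * (1 / q)) ^ (k + 1) ≤ (2 ^ (-(L / 4))) ^ (k + 1) := by
              rw [← hvL]; gcongr
          _ = (2 : ℝ) ^ (-(L / 4) * ((k + 1 : ℕ) : ℝ)) := by
              rw [← Real.rpow_natCast, ← Real.rpow_mul (by norm_num)]
          _ ≤ _ := by
              apply Real.rpow_le_rpow_of_exponent_le (by norm_num)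
              push_cast
              have := mul_le_mul_of_nonneg_left hk2 hL0
              linarith
      calc (u : ℝ) * s * (16 * w * (1 / q)) ^ (k + 1)
          ≤ 2 ^ (L + 0.000009 * L ^ 2) * 2 ^ (-(0.000125 * L ^ 2)) := by
            gcongr
        _ = (2 : ℝ) ^ (L + 0.000009 * L ^ 2 + (-(0.000125 * L ^ 2))) := by
            rw [← Real.rpow_add (by norm_num)]
        _ ≤ _ := by
            apply exp_two_le
            linarith)
    (by
      set P : ℝ := (1 / (128 * (w : ℝ))) ^ d * (1 / q) with hP
      have hP1 : P ≤ 1 := by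
        apply mul_le_one₀ (pow_le_one₀ (by positivity) _) (by positivity)
        · rw [div_le_one hq0]; exact hq1
        · rw [div_le_one (by positivity)]; linarith
      have hPq : 16 * L ≤ P * m := by
        have h5 : P * m = q / (128 * w) ^ d := by
          rw [hP, ← hsqrt, one_div, inv_pow]
          field_simp
        rw [h5, le_div_iff₀ (by positivity)]
        calc 16 * L * (128 * (w : ℝ)) ^ d ≤ 16 * L * (128 * (2 * L ^ 2)) ^ d := by gcongr
          _ = (256 ^ d * 16) * L ^ (2 * d + 1) := by
            rw [show 128 * (2 * L ^ 2) = 256 * L ^ 2 by ring, mul_pow, ← pow_mul]; ring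
          _ ≤ q := e4
      have hm8 : (8 : ℝ) ≤ m := by
        have : (8 : ℝ) ≤ q := by
          have : (1 : ℝ) ≤ L ^ (2 * d + 1) := one_le_pow₀ (by linarith)
          have h6 : (1 : ℝ) ≤ 256 ^ d := one_le_pow₀ (by norm_num)
          have h7 := one_le_mul_of_one_le_of_one_le h6 this
          linarith
        have h8 := le_mul_of_one_le_left hq0.le hq1
        linarith
      have hb : (m : ℝ) / 8 ≤ ((m / 4 : ℕ) : ℝ) := by
        have h7 : 8 ≤ m := by exact_mod_cast hm8
        have : m ≤ 8 * (m / 4) := by omega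
        have h8 : (m : ℝ) ≤ 8 * ((m / 4 : ℕ) : ℝ) := by exact_mod_cast this
        linarith
      have h2 : (2 : ℝ) ^ (m * (k + 1)) ≤ Real.exp (m * L) := by
        have : (2 : ℝ) ≤ Real.exp 1 := by have := Real.exp_one_gt_d9; linarith
        calc (2 : ℝ) ^ (m * (k + 1)) ≤ (Real.exp 1) ^ (m * (k + 1)) := by gcongr
          _ = Real.exp (m * (k + 1)) := by
            rw [← Real.exp_nat_mul]; congr 1; push_cast; ring
          _ ≤ _ := by apply Real.exp_le_exp.mpr; gcongr
      have h3 : (1 - P) ^ (m / 4 * m) ≤ Real.exp (-(2 * (m * L))) := by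
        have h4 : 1 - P ≤ Real.exp (-P) := by
          have := Real.add_one_le_exp (-P); linarith
        calc (1 - P) ^ (m / 4 * m) ≤ (Real.exp (-P)) ^ (m / 4 * m) := by
              apply pow_le_pow_left₀ (by linarith) h4
          _ = Real.exp (-(((m / 4 : ℕ) : ℝ) * (P * m))) := by
              rw [← Real.exp_nat_mul]; congr 1; push_cast; ring
          _ ≤ _ := by
              apply Real.exp_le_exp.mpr
              have : (m : ℝ) / 8 * (16 * L) ≤ ((m / 4 : ℕ) : ℝ) * (P * m) := by gcongr
              linarith
      calc 2 ^ (m * (k + 1)) * (1 - P) ^ (m / 4 * m)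
          ≤ Real.exp (m * L) * Real.exp (-(2 * (m * L))) := by
            apply mul_le_mul h2 h3 (pow_nonneg (by linarith) _) (Real.exp_pos _).le
        _ = Real.exp (-(m * L)) := by rw [← Real.exp_add]; congr 1; ring
        _ ≤ _ := by
            apply Real.exp_le_exp.mpr
            have h9 : (m : ℝ) ^ (0.985 : ℝ) ≤ (m : ℝ) ^ (1 : ℝ) :=
              Real.rpow_le_rpow_of_exponent_le hX1 (by norm_num)
            rw [Real.rpow_one] at h9
            have h10 := le_mul_of_one_le_right hX0.le (by linarith : 1 ≤ L)
            linarith)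
  refine ⟨R, hR, le_trans ?_ hpr⟩
  have h2 : ((d : ℝ) + 2) ≤ Real.exp (1 / 2 * (n : ℝ) ^ (0.49 : ℝ)) := by
    have := Real.add_one_le_exp (1 / 2 * (n : ℝ) ^ (0.49 : ℝ))
    linarith
  have h3 : ((d : ℝ) + 2) * Real.exp (-((n : ℝ) ^ (0.49 : ℝ))) ≤
      Real.exp (-(1 / 2 * (n : ℝ) ^ (0.49 : ℝ))) := by
    calc _ ≤ Real.exp (1 / 2 * (n : ℝ) ^ (0.49 : ℝ)) * Real.exp (-((n : ℝ) ^ (0.49 : ℝ))) := by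
          gcongr
      _ = _ := by rw [← Real.exp_add]; congr 1; ring
  linarith

end SwL

/-- **Lemma B.2 (simultaneous simplification and structure retention for
ANY∘{SYM,THR}∘AC⁰ circuits).** As in Lemma B.1, but with probability at least
`1 - exp(-c_d·n^{0.49})` both: (i) `F↾ρ = h(F'_1,…,F'_u)` with each `F'_i` a
SYM∘AND_k or THR∘AND_k circuit of size at most `s²`, and (ii) `RW_{m,k,r}↾ρ`
contains a perfect copy of `GIP_{m/2,k+1}`. -/
theorem any_sym_thr_simplify_and_retain :
    ∃ τ : ℝ, 0 < τ ∧
      ∀ d : ℕ, ∃ (cd : ℝ) (n₀ : ℕ), 0 < cd ∧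
        ∀ m k r n : ℕ,
          n₀ ≤ n → m = r → k = ⌊(0.0005 : ℝ) * Real.logb 2 (m : ℝ)⌋₊ →
          n = m * (k + 1) * r →
          ∀ u : ℕ, u = ⌊(n : ℝ) ^ (0.249 : ℝ)⌋₊ →
          ∀ s : ℝ, s = (n : ℝ) ^ (τ * Real.logb 2 (n : ℝ)) →
          ∀ (h : (Fin u → Bool) → Bool)
            (Fi : Fin u → (Fin m × Fin (k + 1) × Fin r → Bool) → Bool),
            (∀ i, SymOnAC0 s d (Fi i) ∨ ThrOnAC0 s d (Fi i)) →
            ∃ R : ((Fin m × Fin (k + 1) × Fin r) → Option Bool) → ℝ,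
              IsFair R ∧
              1 - Real.exp (-(cd * (n : ℝ) ^ (0.49 : ℝ))) ≤
                prOf R fun ρ =>
                  (∃ F' : Fin u → (Fin m × Fin (k + 1) × Fin r → Bool) → Bool,
                    (∀ i, IsSymAnd (s ^ 2) (k : ℝ) (F' i) ∨
                      IsThrAnd (s ^ 2) (k : ℝ) (F' i)) ∧
                    ∀ x, restrictF (fun y => h fun i => Fi i y) ρ x =
                      h fun i => F' i x) ∧
                  ContainsGIP (m / 2) (k + 1) (restrictF (RW m k r) ρ) := by
  refine ⟨0.000001, by norm_num, fun d => ?_⟩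
  obtain ⟨N, hN⟩ := SwL.asym d
  refine ⟨1 / 2, N ^ 3, by norm_num, ?_⟩
  intro m k r n hn0 hmr hk hn u hu s hs h Fi hFi
  subst hmr
  have hc := SwL.n_le_cube m k hk
  rw [← hn] at hc
  have hNm : N ≤ m := by
    by_contra hlt
    push Not at hlt
    have := Nat.pow_lt_pow_left hlt (n := 3) (by norm_num)
    omega
  obtain ⟨e1, e2, e3, e4, e5, e6⟩ := hN m hNm
  exact SwL.main_numeric d m k n hk hn u hu s hs _ rfl e1 e2 e3 e4 e5 e6 h Fi hFi
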